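/- arXiv:1311.1616 — 2 statements merged into one kernel-verified Lean document; each statement's English description precedes it below -/
import Mathlib

section
/- Let f : {-1,1}^n → {-1,1} be a Boolean function, let w > 0 be real, and let d ≥ 0 be an integer. Then (1) implies (2) and (2) implies (3), where: (1) deg̃_{1−1/w}(f) > d; (2) W_{1−1/w}(f, d) > 1; (3) W(f, d) > w. -/
open Finset

noncomputable section

/-- The real value of a Boolean bit: `true` encodes `-1` (logical TRUE), `false` encodes `1`. -/
def bval (b : Bool) : ℝ := if b then -1 else 1

/-- The parity character `χ_S(x) = ∏_{i ∈ S} x_i`. -/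
def chi {ι : Type*} (S : Finset ι) (x : ι → Bool) : ℝ := ∏ i ∈ S, bval (x i)

/-- The multilinear polynomial with coefficient family `c`. -/
def polyOf {ι : Type*} [Fintype ι] (c : Finset ι → ℝ) (x : ι → Bool) : ℝ :=
  ∑ S : Finset ι, c S * chi S x

/-- The coefficient family `c` has degree at most `d`. -/
def degLE {ι : Type*} (c : Finset ι → ℝ) (d : ℕ) : Prop :=
  ∀ S : Finset ι, d < S.card → c S = 0

/-- `p` is a pointwise `ε`-approximation to the Boolean function `f`. -/
def IsApprox {ι : Type*} (f : (ι → Bool) → Bool) (p : (ι → Bool) → ℝ) (ε : ℝ) : Prop :=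
  ∀ x, |p x - bval (f x)| ≤ ε

/-- The weight of a polynomial: the `ℓ₁`-norm of its coefficients. -/
def weight {ι : Type*} [Fintype ι] (c : Finset ι → ℝ) : ℝ := ∑ S : Finset ι, |c S|

lemma bval_int (b : Bool) : ∃ z : ℤ, bval b = z := by
  cases b
  · exact ⟨1, by simp [bval]⟩
  · exact ⟨-1, by simp [bval]⟩

lemma bval_abs (b : Bool) : |bval b| = 1 := by
  cases b <;> simp [bval]

lemma chi_int {ι : Type*} (S : Finset ι) (x : ι → Bool) : ∃ z : ℤ, chi S x = z := by
  choose g hg using bval_int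
  exact ⟨∏ i ∈ S, g (x i), by simp [chi, hg]⟩

lemma chi_abs {ι : Type*} (S : Finset ι) (x : ι → Bool) : |chi S x| = 1 := by
  simp [chi, Finset.abs_prod, bval_abs]

lemma polyOf_int {ι : Type*} [Fintype ι] (q : Finset ι → ℤ) (x : ι → Bool) :
    ∃ z : ℤ, polyOf (fun S => (q S : ℝ)) x = z := by
  choose g hg using fun S : Finset ι => chi_int S x
  exact ⟨∑ S, q S * g S, by simp [polyOf, hg]⟩

lemma polyOf_abs_le {ι : Type*} [Fintype ι] (c : Finset ι → ℝ) (x : ι → Bool) :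
    |polyOf c x| ≤ weight c := by
  refine (Finset.abs_sum_le_sum_abs _ _).trans (le_of_eq ?_)
  simp [weight, abs_mul, chi_abs]

/-- (1) `deg̃_{1-1/w}(f) > d` implies (2) `W_{1-1/w}(f, d) > 1`, which implies
(3) `W(f, d) > w` (every degree-`d` integer polynomial threshold function for `f` has
weight greater than `w`). -/
theorem weight_relations (n : ℕ) (f : (Fin n → Bool) → Bool) (w : ℝ) (hw : 0 < w)
    (d : ℕ) :
    ((∀ c : Finset (Fin n) → ℝ, degLE c d → ¬ IsApprox f (polyOf c) (1 - 1/w)) →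
      (∀ c : Finset (Fin n) → ℝ, degLE c d → IsApprox f (polyOf c) (1 - 1/w) →
        1 < weight c)) ∧
    ((∀ c : Finset (Fin n) → ℝ, degLE c d → IsApprox f (polyOf c) (1 - 1/w) →
        1 < weight c) →
      (∀ q : Finset (Fin n) → ℤ, (∀ S, d < S.card → q S = 0) →
        (∀ x, 0 < bval (f x) * polyOf (fun S => (q S : ℝ)) x) →
        w < weight (fun S => (q S : ℝ)))) := by
  refine ⟨fun h c hc ha => absurd ha (h c hc), fun h q hq hpos => ?_⟩
  by_contra hlt
  have hWw := not_lt.mp hlt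
  set W := weight (fun S => (q S : ℝ)) with hW
  have hge : ∀ x, 1 ≤ bval (f x) * polyOf (fun S => (q S : ℝ)) x := by
    intro x
    have hx := hpos x
    obtain ⟨a, ha⟩ := bval_int (f x)
    obtain ⟨b, hb⟩ := polyOf_int q x
    rw [ha, hb] at hx ⊢
    have h0 : 0 < a * b := by exact_mod_cast hx
    have h1 : 1 ≤ a * b := h0
    exact_mod_cast h1
  have hle : ∀ x, bval (f x) * polyOf (fun S => (q S : ℝ)) x ≤ W := by
    intro x
    refine (le_abs_self _).trans ?_
    rw [abs_mul, bval_abs, one_mul]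
    exact polyOf_abs_le _ x
  have hW0 : 0 < W := lt_of_lt_of_le one_pos ((hge fun _ => false).trans (hle _))
  have hweight : weight (fun S => (q S : ℝ) / W) = 1 := by
    have : weight (fun S => (q S : ℝ) / W) = W / W := by
      conv_rhs => rw [hW]
      simp only [weight, abs_div, abs_of_pos hW0, ← Finset.sum_div]
      rfl
    rw [this, div_self hW0.ne']
  have hpoly : ∀ x, polyOf (fun S => (q S : ℝ) / W) x
      = polyOf (fun S => (q S : ℝ)) x / W := by
    intro x
    simp only [polyOf, Finset.sum_div]
    exact Finset.sum_congr rfl fun S _ => by ring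
  refine absurd (h (fun S => (q S : ℝ) / W) ?_ ?_) (by rw [hweight]; exact lt_irrefl _)
  · intro S hS
    simp [hq S hS]
  · intro x
    have h1 : 1 / w ≤ (bval (f x) * polyOf (fun S => (q S : ℝ)) x) / W :=
      (one_div_le_one_div_of_le hW0 hWw).trans (by gcongr; exact hge x)
    have h2 : (bval (f x) * polyOf (fun S => (q S : ℝ)) x) / W ≤ 1 :=
      (div_le_one hW0).2 (hle x)
    rw [mul_div_assoc, ← hpoly x] at h1 h2
    have hb : bval (f x) = 1 ∨ bval (f x) = -1 := by
      cases f x <;> simp [bval]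
    rw [abs_le]
    rcases hb with hb | hb <;> rw [hb] at h1 h2 ⊢ <;> constructor <;> linarith

end
end

section
/- There exist constants c, C > 0 such that for all sufficiently large n there is a Boolean function F : {-1,1}^n → {-1,1} which is a block composition OR_t(ED_N,…,ED_N) of OR_t with disjoint copies of the Element Distinctness function (for suitable t and N with t·N·log₂N ≤ n, the remaining variables being irrelevant), whose pattern-matrix composition F' : {-1,1}^{4n} × {-1,1}^{4n} → {-1,1} satisfies disc(F') ≤ 2^{−c·n^{2/5}/(log₂n)^C}. -/
open Finset

noncomputable section

/-- Read an input `x ∈ {-1,1}^{N·k}` (indexed as `N` blocks of `k` bits) as a function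
`g_x : [N] → [2^k]`, each block giving the binary representation of its value. -/
def gOf {N k : ℕ} (x : Fin N × Fin k → Bool) (i : Fin N) : Fin (2 ^ k) :=
  finFunctionFinEquiv (fun j => if x (i, j) then 1 else 0)

/-- The Element Distinctness function on `N = 2^k` blocks of `k` bits: it is TRUE
(`true`, i.e. `-1`) iff the `N` encoded numbers are pairwise distinct. -/
def ED (k : ℕ) (x : Fin (2 ^ k) × Fin k → Bool) : Bool :=
  decide (Function.Injective (gOf x))

/-- The block composition `OR_t(f, …, f)`; it is TRUE (`true`, i.e. `-1`) iff some copy of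
`f` is TRUE. -/
def orBlock (t : ℕ) {ι : Type*} [Fintype ι] [DecidableEq ι]
    (f : (ι → Bool) → Bool) (x : Fin t × ι → Bool) : Bool :=
  decide (∃ i : Fin t, f (fun j => x (i, j)) = true)

/-- `F` is (up to irrelevant variables) the block composition of `OR_t` with disjoint
copies of Element Distinctness, on some subset of the `n` variables. -/
def IsOrED {n : ℕ} (F : (Fin n → Bool) → Bool) : Prop :=
  ∃ t k : ℕ, ∃ e : Fin t × (Fin (2 ^ k) × Fin k) → Fin n, Function.Injective e ∧
    t * (2 ^ k * k) ≤ n ∧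
    ∀ x : Fin n → Bool, F x = orBlock t (ED k) (fun p => x (e p))

/-- The pattern-matrix composition `F'(x,y) = F(…, OR₄(AND₂(x_{i,j}, y_{i,j})), …)`. -/
def patMat {n : ℕ} (F : (Fin n → Bool) → Bool)
    (x y : Fin n × Fin 4 → Bool) : Bool :=
  F (fun i => decide (∃ j : Fin 4, x (i, j) = true ∧ y (i, j) = true))

theorem growth_bound (g : Polynomial ℝ) (D : ℕ) (hD : g.natDegree ≤ D) (a b B : ℝ)
    (ha : 0 < a) (hab : a < b) (hB : 0 < B)
    (hg : ∀ x, a ≤ x → x ≤ b → |g.eval x| ≤ B) (h : 4 * (D : ℝ) ^ 2 * a ≤ b - a) :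
    |g.eval 0| ≤ 2 * B := by
  have hba : 0 < b - a := by linarith
  have key : ∀ s : ℝ, |s| = 1 → s * g.eval 0 ≤ 2 * B := by
    intro s hs
    set P : Polynomial ℝ := Polynomial.C (s / B) *
      g.comp (Polynomial.C ((a + b) / 2) + Polynomial.C (-((b - a) / 2)) * Polynomial.X) with hP
    have hev : ∀ y, P.eval y = s / B * g.eval ((a + b) / 2 - (b - a) / 2 * y) := by
      intro y
      simp only [hP, Polynomial.eval_mul, Polynomial.eval_C, Polynomial.eval_comp,
        Polynomial.eval_add, Polynomial.eval_X]
      congr 2; ring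
    have hdeg : P.degree ≤ D := by
      apply Polynomial.degree_le_of_natDegree_le
      refine (Polynomial.natDegree_C_mul_le _ _).trans ?_
      refine Polynomial.natDegree_comp_le.trans ?_
      have : (Polynomial.C ((a + b) / 2) + Polynomial.C (-((b - a) / 2)) * Polynomial.X :
        Polynomial ℝ).natDegree ≤ 1 := by
        rw [add_comm]; exact Polynomial.natDegree_linear_le
      calc _ ≤ D * 1 := Nat.mul_le_mul hD this
        _ = D := by ring
    have hbnd : ∀ x ∈ Set.Icc (-1 : ℝ) 1, |P.eval x| ≤ 1 := by
      intro x hx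
      rw [hev, abs_mul, abs_div, hs, abs_of_pos hB]
      have := hg ((a + b) / 2 - (b - a) / 2 * x) (by nlinarith [hx.1, hx.2]) (by nlinarith [hx.1, hx.2])
      rw [div_mul_eq_mul_div, div_le_one hB]; linarith
    set y : ℝ := 1 + 2 * a / (b - a) with hy
    have hy1 : 1 ≤ y := by
      have : 0 ≤ 2 * a / (b - a) := by positivity
      linarith
    have hle := Polynomial.Chebyshev.eval_iterate_derivative_le_of_forall_abs_le_one
      (n := D) (k := 0) (x := y) hy1 hdeg hbnd
    simp only [Function.iterate_zero, id_eq] at hle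
    rw [hev] at hle
    have h0 : (a + b) / 2 - (b - a) / 2 * y = 0 := by
      rw [hy]; field_simp; ring
    rw [h0] at hle
    have hT : (Polynomial.Chebyshev.T ℝ D).eval y ≤ 2 := by
      rw [← Real.cosh_arcosh hy1, Polynomial.Chebyshev.T_real_cosh]
      set θ := Real.arcosh y with hθ
      have hc : Real.cosh θ = y := Real.cosh_arcosh hy1
      have h2 : 1 + θ ^ 2 / 2 ≤ Real.cosh θ := by
        have hθ0 : 0 ≤ θ / 2 := by
          have : 0 ≤ θ := Real.arcosh_nonneg hy1
          linarith
        have e1 : Real.cosh θ = Real.cosh (2 * (θ / 2)) := by congr 1; ring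
        rw [e1, Real.cosh_two_mul, Real.cosh_sq]
        have := Real.self_le_sinh_iff.mpr hθ0
        nlinarith
      have h3 : θ ^ 2 * (b - a) ≤ 4 * a := by
        have : θ ^ 2 / 2 ≤ 2 * a / (b - a) := by linarith
        rw [le_div_iff₀ hba] at this; linarith
      have h4 : ((D:ℝ) * θ) ^ 2 ≤ 1 := by
        by_contra hcon
        push Not at hcon
        have : (D:ℝ)^2 * (θ ^ 2 * (b - a)) ≤ (D:ℝ)^2 * (4 * a) := by gcongr
        nlinarith
      calc Real.cosh (((D:ℕ):ℤ) * θ) ≤ Real.exp ((((D:ℕ):ℤ) * θ) ^ 2 / 2) := Real.cosh_le_exp_half_sq _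
        _ ≤ Real.exp (1 / 2) := by
          apply Real.exp_le_exp.mpr
          push_cast
          linarith
        _ ≤ 2 := by
          have := Real.exp_one_lt_d9
          have h5 : Real.exp (1/2) ^ 2 = Real.exp 1 := by
            rw [← Real.exp_nat_mul]; norm_num
          nlinarith [Real.exp_pos (1/2)]
    have := hle.trans hT
    rw [div_mul_eq_mul_div, div_le_iff₀ hB] at this
    exact this
  rw [abs_le]
  have h1 := key 1 (by norm_num)
  have h2 := key (-1) (by norm_num)
  constructor <;> linarith

theorem prod_erase_split (a b : ℕ) (f : ℕ → ℝ) :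
    ∏ j ∈ (range (a + 1 + b)).erase a, f j = (∏ j ∈ range a, f j) * ∏ j ∈ range b, f (a + 1 + j) := by
  have : (range (a + 1 + b)).erase a = (range a) ∪ (range b).map (addLeftEmbedding (a + 1)) := by
    ext x
    simp only [mem_erase, mem_range, mem_union, mem_map, addLeftEmbedding_apply]
    constructor
    · rintro ⟨h1, h2⟩
      by_cases h : x < a
      · exact Or.inl h
      · exact Or.inr ⟨x - (a+1), by omega, by omega⟩
    · rintro (h | ⟨y, h1, h2⟩) <;> omega
  rw [this, prod_union, prod_map]
  · rfl
  · rw [disjoint_left]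
    simp only [mem_range, mem_map, addLeftEmbedding_apply]
    rintro x hx ⟨y, h1, h2⟩
    omega

theorem denom_prod (a b : ℕ) :
    ∏ j ∈ (range (a + 1 + b)).erase a, |(a : ℝ) - j| = (a.factorial : ℝ) * b.factorial := by
  rw [prod_erase_split]
  congr 1
  · rw [← prod_range_reflect, ← prod_range_add_one_eq_factorial]
    push_cast
    apply prod_congr rfl
    intro j hj
    rw [mem_range] at hj
    rw [abs_of_nonneg]
    · rw [Nat.cast_sub (by omega), Nat.cast_sub (by omega)]; push_cast; ring
    · rw [Nat.cast_sub (by omega), Nat.cast_sub (by omega)]; push_cast; linarith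
  · rw [← prod_range_add_one_eq_factorial]
    push_cast
    apply prod_congr rfl
    intro j hj
    rw [abs_of_nonpos]
    · ring
    · have : (0:ℝ) ≤ j := by positivity
      linarith

theorem numer_prod (n : ℕ) (θ : ℝ) (hθ : |θ| ≤ 1 / 2) :
    ∏ j ∈ (range (n + 1 + n)).erase n, |(n : ℝ) + θ - j| ≤ (n.factorial : ℝ) * n.factorial := by
  rw [prod_erase_split, ← prod_range_reflect, ← prod_mul_distrib, ← prod_range_add_one_eq_factorial]
  push_cast
  rw [← prod_mul_distrib]
  apply prod_le_prod
  · intro i _; positivity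
  · intro j hj
    rw [mem_range] at hj
    rw [← abs_mul, Nat.cast_sub (by omega), Nat.cast_sub (by omega)]
    push_cast
    have : ((n:ℝ) + θ - (n - 1 - j)) * (n + θ - (n + 1 + j)) = θ ^ 2 - (1 + j) ^ 2 := by ring
    rw [this]
    have h1 : θ ^ 2 ≤ 1 := by
      rw [abs_le] at hθ; nlinarith
    have h2 : (0:ℝ) ≤ j := by positivity
    rw [abs_le]; constructor <;> nlinarith [sq_nonneg θ]

theorem interp_basis (n k : ℕ) (hk : k ≤ 2 * n) (θ : ℝ) (hθ : |θ| ≤ 1 / 2) :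
    |(n:ℝ) - k| * (∏ j ∈ (range (2 * n + 1)).erase k, |(n : ℝ) + θ - j| / |(k:ℝ) - j|) ≤ 1 ∧ 
    (k = n → (∏ j ∈ (range (2 * n + 1)).erase k, |(n : ℝ) + θ - j| / |(k:ℝ) - j|) ≤ 1) := by
  have hden : (n.factorial : ℝ) * n.factorial ≤ ∏ j ∈ (range (2 * n + 1)).erase k, |(k:ℝ) - j| := by
    have e : 2 * n + 1 = k + 1 + (2 * n - k) := by omega
    rw [e, denom_prod]
    have h1 := Nat.choose_le_centralBinom k n
    have h2 := Nat.choose_mul_factorial_mul_factorial hk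
    have h3 := Nat.choose_mul_factorial_mul_factorial (show n ≤ 2 * n by omega)
    rw [Nat.centralBinom] at h1
    rw [show 2 * n - n = n by omega] at h3
    have h4 : n.factorial * n.factorial ≤ k.factorial * (2 * n - k).factorial := by
      by_contra hcon
      push Not at hcon
      have hp : 0 < (2*n).choose k := Nat.choose_pos hk
      have : (2*n).choose k * (k.factorial * (2 * n - k).factorial) < (2*n).choose n * (n.factorial * n.factorial) := by
        calc _ < (2*n).choose k * (n.factorial * n.factorial) := by gcongr
          _ ≤ _ := by gcongr
      rw [← mul_assoc, ← mul_assoc, h2, h3] at this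
      exact lt_irrefl _ this
    exact_mod_cast h4
  have hpos : (0:ℝ) < (n.factorial : ℝ) * n.factorial := by positivity
  have hnum := numer_prod n θ hθ
  rw [show n + 1 + n = 2 * n + 1 by ring] at hnum
  constructor
  · by_cases hkn : k = n
    · simp [hkn]
    rw [prod_div_distrib, ← mul_div_assoc, div_le_one (by linarith)]
    refine le_trans ?_ hden
    refine le_trans ?_ hnum
    have hnm : n ∈ range (2 * n + 1) := by rw [mem_range]; omega
    have hkm : k ∈ range (2 * n + 1) := by rw [mem_range]; omega
    rw [← mul_prod_erase ((range (2 * n + 1)).erase k) _ (show n ∈ _ by rw [mem_erase]; exact ⟨Ne.symm hkn, hnm⟩),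
      ← mul_prod_erase ((range (2 * n + 1)).erase n) _ (show k ∈ _ by rw [mem_erase]; exact ⟨hkn, hkm⟩), erase_right_comm, ← mul_assoc]
    apply mul_le_mul_of_nonneg_right _ (prod_nonneg fun _ _ => abs_nonneg _)
    rw [show (n:ℝ) + θ - n = θ by ring]
    have h1 : (1:ℝ) ≤ |(n:ℝ) - k| := by
      have : (1:ℤ) ≤ |(n:ℤ) - k| := Int.one_le_abs (by omega)
      exact_mod_cast this
    have h2 : |(n:ℝ) - k| - |θ| ≤ |(n:ℝ) + θ - k| := by
      have := abs_sub_abs_le_abs_sub ((n:ℝ) - k) (-θ)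
      rw [abs_neg] at this
      convert! this using 2; ring
    nlinarith [abs_nonneg θ, abs_nonneg ((n:ℝ) - k)]
  · rintro rfl
    rw [prod_div_distrib, div_le_one (by linarith)]
    linarith

theorem interp_bound (h : Polynomial ℝ) (m n : ℕ) (hn : n ≤ m) (hdeg : h.natDegree ≤ 2 * n)
    (B : ℝ) (hB : ∀ A : ℕ, m ≤ A + n → A ≤ m + n → |h.eval (A : ℝ)| ≤ B)
    (θ : ℝ) (hθ : |θ| ≤ 1 / 2) : |h.eval (m + θ)| ≤ (3 + 2 * Real.log n) * B := by
  have hB0 : 0 ≤ B := (abs_nonneg _).trans (hB m (by omega) (by omega))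
  set v : ℕ → ℝ := fun k => ((m - n + k : ℕ) : ℝ) with hv
  have hvs : ∀ k, v k = m - n + k := by intro k; simp only [hv]; push_cast [hn]; ring
  have hinj : Set.InjOn v (range (2 * n + 1)) := by
    intro x _ y _ hxy
    rw [hvs, hvs] at hxy
    have : (x:ℝ) = y := by linarith
    exact_mod_cast this
  have heq := Lagrange.eq_interpolate (s := range (2 * n + 1)) (v := v) (f := h) hinj (by
    rw [card_range]
    exact (Polynomial.degree_le_of_natDegree_le hdeg).trans_lt (by exact_mod_cast Nat.lt_succ_self _))
  rw [heq, Lagrange.interpolate_apply, Polynomial.eval_finsetSum]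
  set b : ℕ → ℝ := fun k => ∏ j ∈ (range (2 * n + 1)).erase k, |(n : ℝ) + θ - j| / |(k:ℝ) - j| with hb
  have hterm : ∀ k ∈ range (2 * n + 1), |Polynomial.eval (m + θ) (Polynomial.C (Polynomial.eval (v k) h) * Lagrange.basis (range (2 * n + 1)) v k)| ≤ B * b k := by
    intro k hk
    rw [mem_range] at hk
    rw [Polynomial.eval_mul, Polynomial.eval_C, abs_mul]
    have h1 : |Polynomial.eval (v k) h| ≤ B := hB _ (by omega) (by omega)
    have h2 : |Polynomial.eval (m + θ) (Lagrange.basis (range (2 * n + 1)) v k)| = b k := by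
      rw [Lagrange.basis, Polynomial.eval_prod, abs_prod]
      apply prod_congr rfl
      intro j hj
      rw [Lagrange.basisDivisor, Polynomial.eval_mul, Polynomial.eval_C, Polynomial.eval_sub, Polynomial.eval_X, Polynomial.eval_C, abs_mul, abs_inv, hvs, hvs, div_eq_inv_mul]
      congr 2 <;> ring_nf
    rw [h2]
    exact mul_le_mul_of_nonneg_right h1 (prod_nonneg fun _ _ => by positivity)
  have hbsum : ∑ k ∈ range (2 * n + 1), b k ≤ 3 + 2 * Real.log n := by
    have hharm : ∑ i ∈ range n, ((i:ℝ) + 1)⁻¹ ≤ 1 + Real.log n := by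
      have := harmonic_le_one_add_log n
      simp only [harmonic] at this
      push_cast at this
      exact this
    rw [show 2 * n + 1 = n + (1 + n) by ring, sum_range_add, sum_range_add, sum_range_one, ← sum_range_reflect]
    have h1 : ∑ j ∈ range n, b (n - 1 - j) ≤ ∑ i ∈ range n, ((i:ℝ) + 1)⁻¹ := by
      apply sum_le_sum
      intro i hi
      rw [mem_range] at hi
      have := (interp_basis n (n - 1 - i) (by omega) θ hθ).1
      rw [show |(n:ℝ) - ((n - 1 - i : ℕ) : ℝ)| = i + 1 by
        rw [Nat.cast_sub (by omega), Nat.cast_sub (by omega)]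
        push_cast
        rw [show (n:ℝ) - (n - 1 - i) = i + 1 by ring]
        exact abs_of_nonneg (by positivity)] at this
      rw [← one_div, le_div_iff₀ (by positivity), mul_comm]
      exact this
    have h2 : ∑ j ∈ range n, b (n + (1 + j)) ≤ ∑ i ∈ range n, ((i:ℝ) + 1)⁻¹ := by
      apply sum_le_sum
      intro i hi
      rw [mem_range] at hi
      have := (interp_basis n (n + (1 + i)) (by omega) θ hθ).1
      rw [show |(n:ℝ) - ((n + (1 + i) : ℕ) : ℝ)| = i + 1 by
        push_cast
        rw [show (n:ℝ) - (n + (1 + i)) = -(i + 1) by ring, abs_neg]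
        exact abs_of_nonneg (by positivity)] at this
      rw [← one_div, le_div_iff₀ (by positivity), mul_comm]
      exact this
    have h3 : b (n + 0) ≤ 1 := (interp_basis n n (by omega) θ hθ).2 rfl
    linarith
  calc _ ≤ ∑ k ∈ range (2 * n + 1), B * b k := (abs_sum_le_sum_abs _ _).trans (sum_le_sum hterm)
    _ = (∑ k ∈ range (2 * n + 1), b k) * B := by rw [← mul_sum, mul_comm]
    _ ≤ _ := by gcongr

section PM
set_option linter.unusedSectionVars false
variable {V : Type*} [Fintype V] [DecidableEq V]

theorem sum_prod_pi {C : Type*} [Fintype C] (F : V → C → ℝ) :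
    ∑ c : V → C, ∏ v, F v (c v) = ∏ v, ∑ c, F v c := by
  rw [Finset.prod_univ_sum, Fintype.piFinset_univ]

theorem quad_form {X C : Type*} [Fintype X] [Fintype C] (f : (V → X) → ℝ) (g : C → ℝ)
    (η : C → X → ℝ) :
    ∑ c : V → C, (∏ v, g (c v)) * (∑ a : V → X, f a * ∏ v, η (c v) (a v)) ^ 2 =
    ∑ a : V → X, ∑ a' : V → X, f a * f a' * ∏ v, ∑ c, g c * (η c (a v) * η c (a' v)) := by
  have h1 : ∀ a a' : V → X, ∏ v, ∑ c, g c * (η c (a v) * η c (a' v)) =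
      ∑ c : V → C, (∏ v, g (c v)) * ((∏ v, η (c v) (a v)) * ∏ v, η (c v) (a' v)) := by
    intro a a'
    rw [← sum_prod_pi]
    apply sum_congr rfl
    intro c _
    rw [prod_mul_distrib, prod_mul_distrib]
  simp_rw [h1, sq, sum_mul_sum, mul_sum]
  rw [sum_comm]
  apply sum_congr rfl
  intro a _
  rw [sum_comm]
  apply sum_congr rfl
  intro a' _
  apply sum_congr rfl
  intro c _
  ring

def ch (e z : V → Bool) : ℝ := ∏ v, (if e v then bval (z v) else 1)

theorem bval_sq (b : Bool) : bval b * bval b = 1 := by cases b <;> simp [bval]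

theorem bval_xor (a b : Bool) : bval (xor a b) = bval a * bval b := by
  cases a <;> cases b <;> simp [bval]

theorem prod_ite_eq_pow {X : Type*} [DecidableEq X] (z z' : V → X) (r : ℝ) :
    (∏ v, (if z v = z' v then r else 0)) = if z = z' then r ^ Fintype.card V else 0 := by
  by_cases h : z = z'
  · subst h; simp
  · rw [if_neg h]
    obtain ⟨v, hv⟩ := Function.ne_iff.mp h
    exact prod_eq_zero (mem_univ v) (if_neg hv)

theorem ch_orth (z z' : V → Bool) :
    ∑ e, ch e z * ch e z' = if z = z' then (2:ℝ) ^ Fintype.card V else 0 := by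
  simp only [ch, ← prod_mul_distrib]
  rw [sum_prod_pi (fun v (c : Bool) => (if c then bval (z v) else 1) * (if c then bval (z' v) else 1)),
    ← prod_ite_eq_pow]
  apply prod_congr rfl
  intro v _
  rw [Fintype.sum_bool]
  cases z v <;> cases z' v <;> simp [bval] <;> norm_num

theorem ch_orth' (e e' : V → Bool) :
    ∑ z, ch e z * ch e' z = if e = e' then (2:ℝ) ^ Fintype.card V else 0 := by
  simp only [ch, ← prod_mul_distrib]
  rw [sum_prod_pi (fun v (c : Bool) => (if e v then bval c else 1) * (if e' v then bval c else 1)),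
    ← prod_ite_eq_pow]
  apply prod_congr rfl
  intro v _
  rw [Fintype.sum_bool]
  cases e v <;> cases e' v <;> simp [bval] <;> norm_num

theorem abs_ch (e z : V → Bool) : |ch e z| = 1 := by
  rw [ch, abs_prod]
  apply prod_eq_one
  intro v _
  cases e v <;> cases z v <;> simp [bval]

theorem parseval_ch (c : (V → Bool) → ℝ) :
    ∑ w, (∑ e, c e * ch e w) ^ 2 = (2:ℝ) ^ Fintype.card V * ∑ e, c e ^ 2 := by
  have : ∀ w, (∑ e, c e * ch e w) ^ 2 = ∑ e, ∑ e', c e * c e' * (ch e w * ch e' w) := by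
    intro w
    rw [sq, sum_mul_sum]
    refine sum_congr rfl fun e _ => sum_congr rfl fun e' _ => by ring
  simp_rw [this]
  rw [sum_comm, mul_sum]
  apply sum_congr rfl
  intro e _
  rw [sum_comm]
  simp_rw [← mul_sum, ch_orth']
  simp
  ring

/-- Fourier coefficients -/
def fcoef (ψ : (V → Bool) → ℝ) (e : V → Bool) : ℝ :=
  ((2:ℝ) ^ Fintype.card V)⁻¹ * ∑ z, ψ z * ch e z

theorem fourier_inv (ψ : (V → Bool) → ℝ) (z : V → Bool) :
    ψ z = ∑ e, fcoef ψ e * ch e z := by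
  simp only [fcoef, mul_assoc, ← mul_sum, sum_mul]
  rw [sum_comm]
  simp_rw [← mul_sum, ch_orth]
  simp
  field_simp

theorem fcoef_le (ψ : (V → Bool) → ℝ) (h : ∑ z, |ψ z| ≤ 1) (e : V → Bool) :
    fcoef ψ e ^ 2 ≤ ((4:ℝ) ^ Fintype.card V)⁻¹ := by
  have h1 : |∑ z, ψ z * ch e z| ≤ 1 := by
    refine (abs_sum_le_sum_abs _ _).trans ?_
    simpa [abs_mul, abs_ch] using h
  have h2 : (∑ z, ψ z * ch e z) ^ 2 ≤ 1 := by
    rw [← sq_abs]; exact pow_le_one₀ (abs_nonneg _) h1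
  rw [fcoef, mul_pow, inv_pow, ← pow_mul, mul_comm _ 2, pow_mul,
    show (2:ℝ) ^ 2 = 4 by norm_num]
  exact mul_le_of_le_one_right (by positivity) h2

def pk (p : Bool × Bool) (s : Bool) : Bool := if s then p.2 else p.1

def zz (a : V → Bool × Bool) (s w : V → Bool) : V → Bool := fun v => xor (pk (a v) (s v)) (w v)

theorem ch_zz (e : V → Bool) (a : V → Bool × Bool) (s w : V → Bool) :
    ch e (zz a s w) = ch e (fun v => pk (a v) (s v)) * ch e w := by
  simp only [ch, ← prod_mul_distrib, zz, bval_xor]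
  apply prod_congr rfl
  intro v _
  split_ifs <;> simp

def wt (e : V → Bool) : ℕ := (univ.filter fun v => e v = true).card

theorem bessel_pk (f : (V → Bool × Bool) → ℝ) :
    ∑ s : V → Bool, ∑ e : V → Bool, (2:ℝ) ^ wt e * (∑ a, f a * ch e (fun v => pk (a v) (s v))) ^ 2
      ≤ (8:ℝ) ^ Fintype.card V * ∑ a, f a ^ 2 := by
  have h1 : ∑ s : V → Bool, ∑ e : V → Bool, (2:ℝ) ^ wt e * (∑ a, f a * ch e (fun v => pk (a v) (s v))) ^ 2
      = ∑ c : V → Bool × Bool, (∏ v, (if (c v).2 then (2:ℝ) else 1)) *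
        (∑ a : V → Bool × Bool, f a * ∏ v, (if (c v).2 then bval (pk (a v) (c v).1) else 1)) ^ 2 := by
    rw [← sum_product', univ_product_univ]
    symm
    apply Fintype.sum_equiv (Equiv.arrowProdEquivProdArrow V (fun _ => Bool) (fun _ => Bool))
    intro c
    simp only [Equiv.arrowProdEquivProdArrow, Equiv.coe_fn_mk, ch, wt]
    congr 1
    rw [prod_ite]
    simp
    try rfl
  rw [h1, quad_form f (fun c : Bool × Bool => if c.2 then (2:ℝ) else 1)
    (fun (c : Bool × Bool) (p : Bool × Bool) => if c.2 then bval (pk p c.1) else 1)]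
  set G : Bool × Bool → ℝ := fun c => if c.1 && c.2 then 0 else 2
  set H : Bool × Bool → Bool × Bool → ℝ := fun c p => (if c.1 then bval p.1 else 1) * (if c.2 then bval p.2 else 1)
  have h2 : ∀ p p' : Bool × Bool, ∑ c : Bool × Bool, (if c.2 then (2:ℝ) else 1) *
      ((if c.2 then bval (pk p c.1) else 1) * (if c.2 then bval (pk p' c.1) else 1))
      = ∑ c : Bool × Bool, G c * (H c p * H c p') := by
    rintro ⟨p1, p2⟩ ⟨q1, q2⟩
    simp only [Fintype.sum_prod_type, Fintype.sum_bool, G, H, pk]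
    cases p1 <;> cases p2 <;> cases q1 <;> cases q2 <;> simp [bval] <;> norm_num
  simp_rw [h2]
  rw [← quad_form f G H]
  have h3 : ∑ c : V → Bool × Bool, (∏ v, G (c v)) * (∑ a : V → Bool × Bool, f a * ∏ v, H (c v) (a v)) ^ 2
     ≤ ∑ c : V → Bool × Bool, (∏ v, (fun _ => (2:ℝ)) (c v)) * (∑ a : V → Bool × Bool, f a * ∏ v, H (c v) (a v)) ^ 2 := by
    apply sum_le_sum
    intro c _
    apply mul_le_mul_of_nonneg_right _ (sq_nonneg _)
    apply prod_le_prod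
    · intro v _; simp only [G]; split_ifs <;> norm_num
    · intro v _; simp only [G]; split_ifs <;> norm_num
  refine h3.trans (le_of_eq ?_)
  rw [quad_form f (fun _ => (2:ℝ)) H]
  have h4 : ∀ p p' : Bool × Bool, ∑ c : Bool × Bool, (2:ℝ) * (H c p * H c p') = if p = p' then 8 else 0 := by
    rintro ⟨p1, p2⟩ ⟨q1, q2⟩
    simp only [Fintype.sum_prod_type, Fintype.sum_bool, H]
    cases p1 <;> cases p2 <;> cases q1 <;> cases q2 <;> simp [bval] <;> norm_num
  simp_rw [h4, prod_ite_eq_pow]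
  simp
  rw [mul_sum]
  apply sum_congr rfl; intro a _; ring

theorem pattern_bound (ψ : (V → Bool) → ℝ) (hψ : ∑ z, |ψ z| ≤ 1) (d : ℕ)
    (hd : ∀ e : V → Bool, wt e < d → ∑ z, ψ z * ch e z = 0)
    (f : (V → Bool × Bool) → ℝ) (g : (V → Bool) → (V → Bool) → ℝ)
    (hf : ∀ a, f a ^ 2 ≤ 1) (hg : ∀ s w, g s w ^ 2 ≤ 1) :
    (∑ s, ∑ w, g s w * ∑ a, f a * ψ (zz a s w)) ^ 2 ≤ (64:ℝ) ^ Fintype.card V * ((2:ℝ) ^ d)⁻¹ := by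
  set n := Fintype.card V with hn
  set fs : (V → Bool) → (V → Bool) → ℝ := fun s e => ∑ a, f a * ch e (fun v => pk (a v) (s v)) with hfs
  have hT : ∀ s w, ∑ a, f a * ψ (zz a s w) = ∑ e, (fcoef ψ e * fs s e) * ch e w := by
    intro s w
    simp_rw [fourier_inv ψ (zz _ s w), ch_zz, hfs, mul_sum, sum_mul]
    rw [sum_comm]
    refine sum_congr rfl fun e _ => sum_congr rfl fun a _ => by ring
  have hT2 : ∑ s, ∑ w, (∑ a, f a * ψ (zz a s w)) ^ 2 ≤ (2:ℝ) ^ n * (((4:ℝ) ^ n)⁻¹ * ((2:ℝ) ^ d)⁻¹ * (8 ^ n * 4 ^ n)) := by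
    simp_rw [hT, parseval_ch]
    rw [← mul_sum]
    apply mul_le_mul_of_nonneg_left _ (by positivity)
    have h1 : ∀ s e, (fcoef ψ e * fs s e) ^ 2 ≤ ((4:ℝ) ^ n)⁻¹ * ((2:ℝ) ^ d)⁻¹ * (2 ^ wt e * fs s e ^ 2) := by
      intro s e
      by_cases h : wt e < d
      · rw [fcoef, hd e h]; simp; positivity
      · push Not at h
        have h2 : (1:ℝ) ≤ ((2:ℝ) ^ d)⁻¹ * 2 ^ wt e := by
          rw [← div_eq_inv_mul, le_div_iff₀ (by positivity), one_mul]
          exact pow_le_pow_right₀ (by norm_num) h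
        rw [mul_pow]
        calc _ ≤ ((4:ℝ) ^ n)⁻¹ * fs s e ^ 2 := by
              apply mul_le_mul_of_nonneg_right (fcoef_le ψ hψ e) (sq_nonneg _)
          _ ≤ ((4:ℝ) ^ n)⁻¹ * (((2:ℝ) ^ d)⁻¹ * 2 ^ wt e * fs s e ^ 2) := by
              gcongr
              exact le_mul_of_one_le_left (sq_nonneg _) h2
          _ = _ := by ring
    calc _ ≤ ∑ s, ∑ e, ((4:ℝ) ^ n)⁻¹ * ((2:ℝ) ^ d)⁻¹ * (2 ^ wt e * fs s e ^ 2) :=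
          sum_le_sum fun s _ => sum_le_sum fun e _ => h1 s e
      _ = ((4:ℝ) ^ n)⁻¹ * ((2:ℝ) ^ d)⁻¹ * ∑ s, ∑ e, (2 ^ wt e * fs s e ^ 2) := by
          simp_rw [mul_sum]
      _ ≤ _ := by
          gcongr
          refine (bessel_pk f).trans ?_
          gcongr
          calc ∑ a, f a ^ 2 ≤ ∑ a : V → Bool × Bool, (1:ℝ) := sum_le_sum fun a _ => hf a
            _ = 4 ^ n := by simp [hn]
  rw [← sum_product', univ_product_univ] at hT2 ⊢
  refine (sum_mul_sq_le_sq_mul_sq _ _ _).trans ?_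
  have hG : ∑ i : (V → Bool) × (V → Bool), g i.1 i.2 ^ 2 ≤ 4 ^ n := by
    calc _ ≤ ∑ a : (V → Bool) × (V → Bool), (1:ℝ) := sum_le_sum fun a _ => hg _ _
      _ = 4 ^ n := by simp [hn, ← mul_pow]
  calc _ ≤ (4:ℝ) ^ n * ((2:ℝ) ^ n * (((4:ℝ) ^ n)⁻¹ * ((2:ℝ) ^ d)⁻¹ * (8 ^ n * 4 ^ n))) := by
        apply mul_le_mul hG hT2 (sum_nonneg fun _ _ => sq_nonneg _) (by positivity)
    _ = _ := by
        rw [show (64:ℝ) = 2 * 8 * 4 by norm_num, mul_pow, mul_pow]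
        field_simp

end PM

section DISC
variable {V : Type*} [Fintype V] [DecidableEq V]
set_option linter.unusedSectionVars false

theorem zz_count (G : (V → Bool) → ℝ) :
    ∑ i : (V → Bool × Bool) × ((V → Bool) × (V → Bool)), G (zz i.1 i.2.1 i.2.2)
      = (8:ℝ) ^ Fintype.card V * ∑ z, G z := by
  have h : ∀ (a : V → Bool × Bool) (s : V → Bool), ∑ w, G (zz a s w) = ∑ z, G z := by
    intro a s
    apply Fintype.sum_bijective (fun w => zz a s w)
    · apply Function.Involutive.bijective
      intro w
      funext v
      simp [zz]
    · intro w; rfl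
  rw [Fintype.sum_prod_type]
  simp_rw [Fintype.sum_prod_type, h]
  simp only [sum_const, card_univ, Fintype.card_fun, Fintype.card_prod, Fintype.card_bool,
    nsmul_eq_mul]
  push_cast
  rw [← mul_assoc, ← mul_pow]
  norm_num

theorem push_sum {I X Y : Type*} [Fintype I] [DecidableEq X] [DecidableEq Y]
    (φ : I → X × Y) (r : I → ℝ) (H : X × Y → ℝ) (A : Finset X) (B : Finset Y) :
    ∑ a ∈ A, ∑ b ∈ B, (∑ i, if φ i = (a, b) then r i else 0) * H (a, b) =
    ∑ i, (if (φ i).1 ∈ A then (1:ℝ) else 0) * (if (φ i).2 ∈ B then (1:ℝ) else 0) * (r i * H (φ i)) := by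
  rw [← sum_product' A B (fun a b => (∑ i, if φ i = (a, b) then r i else 0) * H (a, b))]
  simp_rw [sum_mul]
  rw [sum_comm]
  apply sum_congr rfl
  intro i _
  have : ∀ p : X × Y, (if φ i = (p.1, p.2) then r i else 0) * H (p.1, p.2)
      = if φ i = p then r i * H (φ i) else 0 := by
    rintro ⟨a, b⟩
    split_ifs with h
    · rw [h]
    · simp
  simp_rw [this]
  rw [sum_ite_eq]
  by_cases h1 : (φ i).1 ∈ A <;> by_cases h2 : (φ i).2 ∈ B <;> simp [mem_product, h1, h2]

def alB (p : Bool × Bool) (j : Fin 4) : Bool := ![p.1, !p.1, p.2, !p.2] j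
def beB (p : Bool × Bool) (j : Fin 4) : Bool :=
  ![!p.1 && !p.2, !p.1 && p.2, p.1 && !p.2, p.1 && p.2] j

theorem alB_beB (p : Bool × Bool) (s w : Bool) :
    decide (∃ j : Fin 4, alB p j = true ∧ beB (s, w) j = true) = xor (pk p s) w := by
  obtain ⟨p1, p2⟩ := p
  revert p1 p2 s w
  decide

theorem disc_lemma {n : ℕ} (F0 : (V → Bool) → Bool) (ρ ψ : (V → Bool) → ℝ)
    (hρ0 : ∀ z, 0 ≤ ρ z) (hρ1 : ∑ z, ρ z = 1) (hψ : ∑ z, |ψ z| ≤ 1) (d : ℕ)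
    (hd : ∀ e : V → Bool, wt e < d → ∑ z, ψ z * ch e z = 0) (η : ℝ)
    (hη : ∑ z, |ρ z * bval (F0 z) - ψ z| ≤ η) (e : V → Fin n) (he : Function.Injective e)
    (F : (Fin n → Bool) → Bool) (hF : ∀ x, F x = F0 (fun v => x (e v))) :
    ∃ μ : (Fin n × Fin 4 → Bool) × (Fin n × Fin 4 → Bool) → ℝ,
          (∀ ab, 0 ≤ μ ab) ∧
          (∑ ab : (Fin n × Fin 4 → Bool) × (Fin n × Fin 4 → Bool), μ ab = 1) ∧
          ∀ A B : Finset (Fin n × Fin 4 → Bool),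
            |∑ a ∈ A, ∑ b ∈ B, μ (a, b) * bval (patMat F a b)| ≤ η + Real.sqrt (((2:ℝ) ^ d)⁻¹) := by
  set al : (V → Bool × Bool) → (Fin n × Fin 4 → Bool) :=
    fun a p => Function.extend e (fun v => alB (a v)) (fun _ _ => false) p.1 p.2 with hal
  set be : (V → Bool) × (V → Bool) → (Fin n × Fin 4 → Bool) :=
    fun a p => Function.extend e (fun v => beB (a.1 v, a.2 v)) (fun _ _ => false) p.1 p.2 with hbe
  have hpm : ∀ a s, patMat F (al a) (be s) = F0 (zz a s.1 s.2) := by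
    intro a s
    rw [patMat, hF]
    congr 1
    funext v
    simp only [hal, hbe, he.extend_apply, alB_beB, zz]
  set c : ℝ := (8:ℝ) ^ Fintype.card V with hc
  have hc0 : 0 < c := by positivity
  set φ : (V → Bool × Bool) × ((V → Bool) × (V → Bool)) →
    (Fin n × Fin 4 → Bool) × (Fin n × Fin 4 → Bool) := fun i => (al i.1, be i.2) with hφ
  set r : (V → Bool × Bool) × ((V → Bool) × (V → Bool)) → ℝ :=
    fun i => c⁻¹ * ρ (zz i.1 i.2.1 i.2.2) with hr
  have hr0 : ∀ i, 0 ≤ r i := fun i => mul_nonneg (by positivity) (hρ0 _)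
  have hr1 : ∑ i, r i = 1 := by
    simp only [hr]
    rw [← mul_sum, zz_count, hρ1, ← hc]
    field_simp
  refine ⟨fun p => ∑ i, if φ i = p then r i else 0, ?_, ?_, ?_⟩
  · intro p
    apply sum_nonneg
    intro i _
    split_ifs
    · exact hr0 i
    · exact le_rfl
  · rw [sum_comm]
    simpa using hr1
  · intro A B
    have := push_sum φ r (fun p => bval (patMat F p.1 p.2)) A B
    simp only at this ⊢
    rw [this]
    set f : (V → Bool × Bool) → ℝ := fun a => if al a ∈ A then (1:ℝ) else 0 with hf
    set g : (V → Bool) × (V → Bool) → ℝ := fun s => if be s ∈ B then (1:ℝ) else 0 with hg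
    have hf1 : ∀ a, |f a| ≤ 1 := by intro a; simp only [hf]; split_ifs <;> simp
    have hg1 : ∀ a, |g a| ≤ 1 := by intro a; simp only [hg]; split_ifs <;> simp
    have hsplit : ∑ i, (if (φ i).1 ∈ A then (1:ℝ) else 0) * (if (φ i).2 ∈ B then (1:ℝ) else 0) *
          (r i * bval (patMat F (φ i).1 (φ i).2)) =
        c⁻¹ * ∑ i : (V → Bool × Bool) × ((V → Bool) × (V → Bool)), f i.1 * g i.2 * (ρ (zz i.1 i.2.1 i.2.2) * bval (F0 (zz i.1 i.2.1 i.2.2)) - ψ (zz i.1 i.2.1 i.2.2))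
        + c⁻¹ * ∑ s, ∑ w, g (s, w) * ∑ a, f a * ψ (zz a s w) := by
      have h2 : ∑ s, ∑ w, g (s, w) * ∑ a, f a * ψ (zz a s w)
        = ∑ i : (V → Bool × Bool) × ((V → Bool) × (V → Bool)), f i.1 * g i.2 * ψ (zz i.1 i.2.1 i.2.2) := by
        rw [Fintype.sum_prod_type_right, Fintype.sum_prod_type]
        refine sum_congr rfl fun s _ => sum_congr rfl fun w _ => ?_
        rw [mul_sum]
        refine sum_congr rfl fun a _ => ?_
        simp only
        ring
      rw [h2, ← mul_add, ← sum_add_distrib, mul_sum]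
      refine sum_congr rfl fun i _ => ?_
      simp only [hφ, hpm, hr, hf, hg]
      ring
    rw [hsplit]
    refine (abs_add_le _ _).trans (add_le_add ?_ ?_)
    · rw [abs_mul, abs_of_pos (inv_pos.mpr hc0), inv_mul_le_iff₀ hc0]
      calc _ ≤ ∑ i : (V → Bool × Bool) × ((V → Bool) × (V → Bool)), |f i.1 * g i.2 * (ρ (zz i.1 i.2.1 i.2.2) * bval (F0 (zz i.1 i.2.1 i.2.2)) - ψ (zz i.1 i.2.1 i.2.2))| := abs_sum_le_sum_abs _ _
        _ ≤ ∑ i : (V → Bool × Bool) × ((V → Bool) × (V → Bool)), |(ρ (zz i.1 i.2.1 i.2.2) * bval (F0 (zz i.1 i.2.1 i.2.2)) - ψ (zz i.1 i.2.1 i.2.2))| := by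
            apply sum_le_sum
            intro i _
            rw [abs_mul, abs_mul]
            apply mul_le_of_le_one_left (abs_nonneg _)
            exact mul_le_one₀ (hf1 _) (abs_nonneg _) (hg1 _)
        _ = c * ∑ z, |ρ z * bval (F0 z) - ψ z| := zz_count (fun z => |ρ z * bval (F0 z) - ψ z|)
        _ ≤ c * η := by gcongr
    · rw [abs_mul, abs_of_pos (inv_pos.mpr hc0), inv_mul_le_iff₀ hc0]
      have hpb := pattern_bound ψ hψ d hd f (fun s w => g (s, w))
        (fun a => by rw [← sq_abs]; exact pow_le_one₀ (abs_nonneg _) (hf1 a))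
        (fun s w => by rw [← sq_abs]; exact pow_le_one₀ (abs_nonneg _) (hg1 _))
      have h64 : (64:ℝ) ^ Fintype.card V = c ^ 2 := by
        rw [hc, ← pow_mul, mul_comm, pow_mul]; norm_num
      rw [h64] at hpb
      have := Real.abs_le_sqrt hpb
      rwa [Real.sqrt_mul (by positivity), Real.sqrt_sq hc0.le] at this
end DISC

section ORA
variable {ι : Type*} [Fintype ι] [DecidableEq ι]
set_option linter.unusedSectionVars false

theorem sum_blocks {t : ℕ} (G : Fin t → (ι → Bool) → ℝ) :
    ∑ z : Fin t × ι → Bool, ∏ i, G i (fun j => z (i, j)) = ∏ i, ∑ x, G i x := by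
  rw [← sum_prod_pi]
  exact Fintype.sum_equiv (Equiv.curry (Fin t) ι Bool) _ _ (fun z => rfl)

theorem ch_blocks {t : ℕ} (e z : Fin t × ι → Bool) :
    ch e z = ∏ i, ch (fun j => e (i, j)) (fun j => z (i, j)) := by
  simp only [ch]
  rw [Fintype.prod_prod_type]

theorem wt_block {t : ℕ} (e : Fin t × ι → Bool) (i : Fin t) : wt (fun j => e (i, j)) ≤ wt e := by
  unfold wt
  apply card_le_card_of_injOn (fun j => (i, j))
  · intro j hj
    simpa using hj
  · intro a _ b _ h
    simpa using h

theorem or_amp {n t d : ℕ} (f : (ι → Bool) → Bool) (P Q : (ι → Bool) → ℝ)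
    (hP0 : ∀ x, 0 ≤ P x) (hQ0 : ∀ x, 0 ≤ Q x) (hP1 : ∑ x, P x = 1) (hQ1 : ∑ x, Q x = 1)
    (hPf : ∀ x, f x = true → P x = 0)
    (hm : ∀ e : ι → Bool, wt e < d → ∑ x, P x * ch e x = ∑ x, Q x * ch e x)
    (η : ℝ) (hQ : ∑ x, (if f x = true then 0 else Q x) ≤ η)
    (e : Fin t × ι → Fin n) (he : Function.Injective e) (F : (Fin n → Bool) → Bool)
    (hF : ∀ x, F x = orBlock t f (fun v => x (e v))) :
    ∃ μ : (Fin n × Fin 4 → Bool) × (Fin n × Fin 4 → Bool) → ℝ,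
          (∀ ab, 0 ≤ μ ab) ∧
          (∑ ab : (Fin n × Fin 4 → Bool) × (Fin n × Fin 4 → Bool), μ ab = 1) ∧
          ∀ A B : Finset (Fin n × Fin 4 → Bool),
            |∑ a ∈ A, ∑ b ∈ B, μ (a, b) * bval (patMat F a b)| ≤ η ^ t + Real.sqrt (((2:ℝ) ^ d)⁻¹) := by
  set PP : (Fin t × ι → Bool) → ℝ := fun z => ∏ i, P (fun j => z (i, j)) with hPP
  set QQ : (Fin t × ι → Bool) → ℝ := fun z => ∏ i, Q (fun j => z (i, j)) with hQQ
  have hPP0 : ∀ z, 0 ≤ PP z := fun z => prod_nonneg fun i _ => hP0 _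
  have hQQ0 : ∀ z, 0 ≤ QQ z := fun z => prod_nonneg fun i _ => hQ0 _
  have hPP1 : ∑ z, PP z = 1 := by
    simp only [hPP]; rw [sum_blocks (fun _ => P)]; simp [hP1]
  have hQQ1 : ∑ z, QQ z = 1 := by
    simp only [hQQ]; rw [sum_blocks (fun _ => Q)]; simp [hQ1]
  apply disc_lemma (orBlock t f) (fun z => (PP z + QQ z) / 2) (fun z => (PP z - QQ z) / 2)
    (e := e) (he := he) (F := F) (hF := hF)
  · intro z
    have := hPP0 z; have := hQQ0 z
    positivity
  · rw [← sum_div, sum_add_distrib, hPP1, hQQ1]; norm_num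
  · calc ∑ z, |(PP z - QQ z) / 2| ≤ ∑ z, (PP z + QQ z) / 2 := by
          apply sum_le_sum
          intro z _
          have := hPP0 z; have := hQQ0 z
          rw [abs_le]; constructor <;> linarith
      _ = 1 := by rw [← sum_div, sum_add_distrib, hPP1, hQQ1]; norm_num
      _ ≤ 1 := le_rfl
  · intro e' he'
    have h1 : ∑ z, PP z * ch e' z = ∑ z, QQ z * ch e' z := by
      simp only [hPP, hQQ, ch_blocks e', ← prod_mul_distrib]
      rw [sum_blocks (fun i x => P x * ch (fun j => e' (i, j)) x),
        sum_blocks (fun i x => Q x * ch (fun j => e' (i, j)) x)]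
      apply prod_congr rfl
      intro i _
      exact hm _ ((wt_block e' i).trans_lt he')
    have : ∀ z, (PP z - QQ z) / 2 * ch e' z = (PP z * ch e' z - QQ z * ch e' z) / 2 := by
      intro z; ring
    simp_rw [this]
    rw [← sum_div, sum_sub_distrib, h1]; simp
  · have h1 : ∀ z : Fin t × ι → Bool, |(PP z + QQ z) / 2 * bval (orBlock t f z) - (PP z - QQ z) / 2|
        = ∏ i, (if f (fun j => z (i, j)) = true then 0 else Q (fun j => z (i, j))) := by
      intro z
      by_cases h : ∃ i : Fin t, f (fun j => z (i, j)) = true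
      · have hb : orBlock t f z = true := by simp [orBlock, h]
        obtain ⟨i, hi⟩ := h
        have : PP z = 0 := prod_eq_zero (mem_univ i) (hPf _ hi)
        rw [prod_eq_zero (mem_univ i) (by simp [hi]), hb, this]
        simp [bval]
        ring
      · have hb : orBlock t f z = false := by simp only [orBlock, h]; rfl
        push Not at h
        have h2 : ∏ i, (if f (fun j => z (i, j)) = true then 0 else Q (fun j => z (i, j))) = QQ z :=
          prod_congr rfl fun i _ => if_neg (h i)
        rw [h2, hb]
        simp only [bval]
        rw [show (PP z + QQ z) / 2 * (if false = true then (-1:ℝ) else 1) - (PP z - QQ z) / 2 = QQ z by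
          simp; ring]
        exact abs_of_nonneg (hQQ0 z)
    simp_rw [h1]
    rw [sum_blocks (fun _ x => if f x = true then 0 else Q x), prod_const, card_univ, Fintype.card_fin]
    apply pow_le_pow_left₀ _ hQ
    apply sum_nonneg
    intro x _
    split_ifs
    · exact le_rfl
    · exact hQ0 x
end ORA

section DUAL
variable {X : Type*} [Fintype X] [DecidableEq X]
set_option linter.unusedSectionVars false

theorem duality (f : X → Bool) (U : X → ℝ) (hU0 : ∀ x, 0 ≤ U x) (hU1 : ∑ x, U x = 1)
    (hUf : ∀ x, f x = false → U x = 0) (L : Submodule ℝ (X → ℝ)) (h1 : (fun _ => (1:ℝ)) ∈ L)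
    (M : ℝ) (hM : 0 < M)
    (hL : ∀ p ∈ L, (∀ x, f x = false → |p x| ≤ 1) → |∑ x, U x * p x| ≤ M) :
    ∃ P Q : X → ℝ, (∀ x, 0 ≤ P x) ∧ (∀ x, 0 ≤ Q x) ∧ ∑ x, P x = 1 ∧ ∑ x, Q x = 1 ∧
      (∀ x, f x = true → P x = 0) ∧ (∀ p ∈ L, ∑ x, P x * p x = ∑ x, Q x * p x) ∧
      ∑ x, (if f x = true then 0 else Q x) ≤ 1 - 2 / (M + 1) := by
  classical
  set u : (X → ℝ) →ₗ[ℝ] ℝ :=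
    { toFun := fun p => ∑ x, U x * p x
      map_add' := by intro p q; simp [mul_add, sum_add_distrib]
      map_smul' := by intro c p; simp [mul_sum]; exact sum_congr rfl fun x _ => by ring } with hu
  have hu' : ∀ p, u p = ∑ x, U x * p x := fun p => rfl
  set res : (X → ℝ) → ({x // f x = false} → ℝ) := fun p x => p x with hres
  set Nn : (X → ℝ) → ℝ := fun p => M * ‖res p‖ with hNn
  have hbound : ∀ p ∈ L, u p ≤ Nn p := by
    intro p hp
    apply le_of_forall_pos_le_add
    intro ε hε
    set r := ‖res p‖ + ε / M with hr
    have hr0 : 0 < r := by positivity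
    have h2 : |∑ x, U x * (r⁻¹ • p) x| ≤ M := by
      apply hL _ (L.smul_mem _ hp)
      intro x hx
      have h3 : |p x| ≤ ‖res p‖ := norm_le_pi_norm (res p) ⟨x, hx⟩
      simp only [Pi.smul_apply, smul_eq_mul, abs_mul, abs_inv, abs_of_pos hr0]
      rw [inv_mul_le_iff₀ hr0]
      have : 0 < ε / M := by positivity
      linarith
    have h4 : ∑ x, U x * (r⁻¹ • p) x = r⁻¹ * u p := by
      rw [hu', mul_sum]
      refine sum_congr rfl fun x _ => ?_
      simp; ring
    rw [h4] at h2
    have h5 := (le_abs_self _).trans h2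
    rw [inv_mul_le_iff₀ hr0] at h5
    calc u p ≤ r * M := h5
      _ = _ := by rw [hr, hNn]; field_simp
  obtain ⟨g, hg1, hg2⟩ := exists_extension_of_le_sublinear (E := X → ℝ)
    ⟨L, u.comp L.subtype⟩ Nn
    (by
      intro c hc p
      have : res (c • p) = c • res p := rfl
      simp only [hNn]
      rw [this, norm_smul, Real.norm_eq_abs, abs_of_pos hc]
      ring)
    (by
      intro p q
      have : res (p + q) = res p + res q := rfl
      simp only [hNn]
      rw [this, ← mul_add]
      exact mul_le_mul_of_nonneg_left (norm_add_le _ _) hM.le)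
    (by
      rintro ⟨p, hp⟩
      exact hbound p hp)
  have hgL : ∀ p ∈ L, g p = ∑ x, U x * p x := fun p hp => hg1 ⟨p, hp⟩
  set lam : X → ℝ := fun x => g (Pi.single x 1) with hlam
  have hgs : ∀ p, g p = ∑ x, lam x * p x := by
    intro p
    have h : p = ∑ x, p x • Pi.single x (1:ℝ) := by
      funext y
      simp [Pi.single_apply]
    conv_lhs => rw [h]
    rw [map_sum]
    refine sum_congr rfl fun x _ => ?_
    rw [map_smul, smul_eq_mul, mul_comm]
  have hlam0 : ∀ x, f x = true → lam x = 0 := by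
    intro x hx
    have h0 : ∀ c : ℝ, res (Pi.single x c) = 0 := by
      intro c
      funext ⟨y, hy⟩
      have : y ≠ x := by rintro rfl; simp [hx] at hy
      simp [hres, Pi.single_apply, this]
    have e1 := hg2 (Pi.single x 1)
    have e2 := hg2 (Pi.single x (-1))
    simp only [hNn, h0, norm_zero, mul_zero] at e1 e2
    rw [hgs] at e2
    simp [Pi.single_apply] at e2
    exact le_antisymm e1 e2
  have hlamM : ∑ x, |lam x| ≤ M := by
    have := hg2 (fun x => if 0 ≤ lam x then 1 else -1)
    rw [hgs] at this
    calc ∑ x, |lam x| = ∑ x, lam x * (if 0 ≤ lam x then 1 else -1) := by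
          refine sum_congr rfl fun x _ => ?_
          split_ifs with h
          · rw [abs_of_nonneg h]; ring
          · rw [abs_of_neg (not_le.mp h)]; ring
      _ ≤ M * ‖res (fun x => if 0 ≤ lam x then 1 else -1)‖ := this
      _ ≤ M * 1 := by
          apply mul_le_mul_of_nonneg_left _ hM.le
          apply (pi_norm_le_iff_of_nonneg zero_le_one).mpr
          intro x
          simp only [hres]
          split_ifs <;> simp
      _ = M := mul_one M
  have hlam1 : ∑ x, lam x = 1 := by
    have h := hgL _ h1
    rw [hgs] at h
    simpa [hU1] using h
  set lp : X → ℝ := fun x => max (lam x) 0 with hlp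
  set lm : X → ℝ := fun x => max (-lam x) 0 with hlm
  have hpm : ∀ x, lp x - lm x = lam x := by
    intro x; simp only [hlp, hlm]
    rcases le_total 0 (lam x) with h | h
    · rw [max_eq_left h, max_eq_right (by linarith)]; ring
    · rw [max_eq_right h, max_eq_left (by linarith)]; ring
  have hpa : ∀ x, lp x + lm x = |lam x| := by
    intro x; simp only [hlp, hlm]
    rcases le_total 0 (lam x) with h | h
    · rw [max_eq_left h, max_eq_right (by linarith), abs_of_nonneg h]; ring
    · rw [max_eq_right h, max_eq_left (by linarith), abs_of_nonpos h]; ring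
  have hlp0 : ∀ x, 0 ≤ lp x := fun x => le_max_right _ _
  have hlm0 : ∀ x, 0 ≤ lm x := fun x => le_max_right _ _
  set S := ∑ x, lp x with hS
  have hSm : ∑ x, lm x = S - 1 := by
    have : ∑ x, (lp x - lm x) = 1 := by simp_rw [hpm]; exact hlam1
    rw [sum_sub_distrib] at this
    linarith
  have hS1 : 1 ≤ S := by
    have : 0 ≤ ∑ x, lm x := sum_nonneg fun x _ => hlm0 x
    linarith
  have hSM : 2 * S ≤ M + 1 := by
    have : ∑ x, (lp x + lm x) ≤ M := by simp_rw [hpa]; exact hlamM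
    rw [sum_add_distrib] at this
    linarith
  have hSp : 0 < S := by linarith
  refine ⟨fun x => lp x / S, fun x => (lm x + U x) / S, ?_, ?_, ?_, ?_, ?_, ?_, ?_⟩
  · intro x; exact div_nonneg (hlp0 x) hSp.le
  · intro x; exact div_nonneg (add_nonneg (hlm0 x) (hU0 x)) hSp.le
  · rw [← sum_div, ← hS]; field_simp
  · rw [← sum_div, sum_add_distrib, hSm, hU1]; field_simp; ring
  · intro x hx
    simp [hlp, hlam0 x hx]
  · intro p hp
    have h := hgL p hp
    rw [hgs] at h
    simp_rw [← hpm, sub_mul] at h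
    rw [sum_sub_distrib] at h
    simp_rw [div_mul_eq_mul_div, add_mul, ← sum_div, sum_add_distrib]
    congr 1
    linarith
  · have h : ∀ x, (if f x = true then 0 else (lm x + U x) / S) = lm x / S := by
      intro x
      split_ifs with hx
      · simp [hlm, hlam0 x hx]
      · rw [hUf x (by simpa using hx), add_zero]
    simp_rw [h]
    rw [← sum_div, hSm]
    have : (2:ℝ) / (M + 1) ≤ 1 / S := by
      rw [div_le_div_iff₀ (by linarith) hSp]; linarith
    rw [sub_div, div_self hSp.ne']
    linarith
end DUAL

section MODEL
variable {ι : Type*} [Fintype ι] [DecidableEq ι]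
set_option linter.unusedSectionVars false

def wgt (A : ℕ) (x : ℝ) (o : Option (Fin A)) : ℝ := if o = none then 1 - A * x else x

theorem wgt_sum (A : ℕ) (x : ℝ) : ∑ o, wgt A x o = 1 := by
  rw [Fintype.sum_option]
  simp [wgt]

def csetoid {A : ℕ} (c : ι → Option (Fin A)) : Setoid ι where
  r i j := i = j ∨ (c i = c j ∧ c i ≠ none)
  iseqv := by
    refine ⟨fun i => Or.inl rfl, ?_, ?_⟩
    · rintro i j (h | ⟨h1, h2⟩)
      · exact Or.inl h.symm
      · exact Or.inr ⟨h1.symm, h1 ▸ h2⟩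
    · rintro i j k (h | ⟨h1, h2⟩) (h' | ⟨h1', h2'⟩)
      · exact Or.inl (h.trans h')
      · subst h; exact Or.inr ⟨h1', h2'⟩
      · subst h'; exact Or.inr ⟨h1, h2⟩
      · exact Or.inr ⟨h1.trans h1', h2⟩

def rep {A : ℕ} (c : ι → Option (Fin A)) (i : ι) : ι := (Quotient.mk (csetoid c) i).out

theorem rep_eq_iff {A : ℕ} (c : ι → Option (Fin A)) (i j : ι) :
    rep c i = rep c j ↔ (i = j ∨ (c i = c j ∧ c i ≠ none)) := by
  unfold rep
  rw [Quotient.out_inj, Quotient.eq]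
  rfl

def avg (p : (ι → ι) → ℝ) (r : ι → ι) : ℝ :=
  (∑ σ : Equiv.Perm ι, p (σ ∘ r)) / (Fintype.card (Equiv.Perm ι) : ℝ)

def EE (A : ℕ) (x : ℝ) (p : (ι → ι) → ℝ) : ℝ :=
  ∑ c : ι → Option (Fin A), (∏ i, wgt A x (c i)) * avg p (rep c)

def DepOn (f : (ι → ι) → ℝ) (T : Finset ι) : Prop :=
  ∀ g h : ι → ι, (∀ i ∈ T, g i = h i) → f g = f h

theorem exists_perm_of_ker (T : Finset ι) (u v : ι → ι)
    (h : ∀ i ∈ T, ∀ j ∈ T, u i = u j ↔ v i = v j) :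
    ∃ π : Equiv.Perm ι, ∀ i ∈ T, π (u i) = v i := by
  classical
  have key : ∀ x : {x // x ∈ T.image u}, ∃ i ∈ T, u i = x.1 := fun x => mem_image.mp x.2
  choose s hs hs' using key
  have key' : ∀ x : {x // x ∈ T.image v}, ∃ i ∈ T, v i = x.1 := fun x => mem_image.mp x.2
  choose s' hs1 hs1' using key'
  let e : {x // x ∈ T.image u} ≃ {x // x ∈ T.image v} :=
    { toFun := fun x => ⟨v (s x), mem_image_of_mem v (hs x)⟩
      invFun := fun y => ⟨u (s' y), mem_image_of_mem u (hs1 y)⟩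
      left_inv := by
        intro x
        apply Subtype.ext
        show u (s' _) = x.1
        rw [← hs' x]
        rw [h _ (hs1 _) _ (hs x)]
        exact hs1' ⟨v (s x), mem_image_of_mem v (hs x)⟩
      right_inv := by
        intro y
        apply Subtype.ext
        show v (s _) = y.1
        rw [← hs1' y]
        rw [← h _ (hs _) _ (hs1 y)]
        exact hs' ⟨u (s' y), mem_image_of_mem u (hs1 y)⟩ }
  refine ⟨e.extendSubtype, fun i hi => ?_⟩
  rw [Equiv.extendSubtype_apply_of_mem e (u i) (mem_image_of_mem u hi)]
  show v (s _) = v i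
  rw [← h _ (hs _) _ hi]
  exact hs' ⟨u i, mem_image_of_mem u hi⟩

theorem avg_congr (f : (ι → ι) → ℝ) (T : Finset ι) (hf : DepOn f T) (u v : ι → ι)
    (h : ∀ i ∈ T, ∀ j ∈ T, u i = u j ↔ v i = v j) : avg f u = avg f v := by
  obtain ⟨π, hπ⟩ := exists_perm_of_ker T u v h
  unfold avg
  congr 1
  symm
  apply Fintype.sum_equiv (Equiv.mulRight π)
  intro σ
  apply hf
  intro i hi
  simp [← hπ i hi]

theorem avg_inj (p : (ι → ι) → ℝ) (r : ι → ι) (hr : Function.Injective r) :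
    avg p r = avg p id := by
  apply avg_congr p univ
  · intro g h hgh
    congr 1
    funext i
    exact hgh i (mem_univ i)
  · intro i _ j _
    simpa using hr.eq_iff

theorem abs_avg_le (p : (ι → ι) → ℝ) (r : ι → ι) (hr : ¬ Function.Injective r)
    (hp : ∀ g : ι → ι, ¬ Function.Injective g → |p g| ≤ 1) : |avg p r| ≤ 1 := by
  unfold avg
  rw [abs_div, abs_of_nonneg (Nat.cast_nonneg _ : (0:ℝ) ≤ _)]
  apply div_le_one_of_le₀ _ (Nat.cast_nonneg _)
  refine (abs_sum_le_sum_abs _ _).trans ?_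
  calc _ ≤ ∑ σ : Equiv.Perm ι, (1:ℝ) := by
        apply sum_le_sum
        intro σ _
        apply hp
        intro h
        exact hr (Function.Injective.of_comp h)
    _ = _ := by simp

open Classical in
def NC (A : ℕ) (x : ℝ) (ι : Type*) [Fintype ι] [DecidableEq ι] : ℝ :=
  ∑ c : ι → Option (Fin A), (∏ i, wgt A x (c i)) * if Function.Injective (rep c) then 1 else 0

theorem abs_EE_le (A : ℕ) (x : ℝ) (hx : 0 ≤ x) (hA : A * x ≤ 1) (p : (ι → ι) → ℝ)
    (hp : ∀ g : ι → ι, ¬ Function.Injective g → |p g| ≤ 1) :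
    |EE A x p| ≤ NC A x ι * |avg p id| + 1 := by
  classical
  have hw : ∀ o, 0 ≤ wgt A x o := by
    intro o; unfold wgt; split_ifs <;> linarith
  have hw1 : ∑ c : ι → Option (Fin A), ∏ i, wgt A x (c i) = 1 := by
    rw [sum_prod_pi (fun _ o => wgt A x o), wgt_sum, prod_const_one]
  unfold EE NC
  refine (abs_sum_le_sum_abs _ _).trans ?_
  rw [sum_mul]
  conv_rhs => rw [← hw1, ← sum_add_distrib]
  apply sum_le_sum
  intro c _
  have h0 : 0 ≤ ∏ i, wgt A x (c i) := prod_nonneg fun i _ => hw _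
  rw [abs_mul, abs_of_nonneg h0]
  by_cases h : Function.Injective (rep c)
  · rw [if_pos h, avg_inj p _ h, hw1, mul_one]
    linarith
  · rw [if_neg h, mul_zero, zero_mul, zero_add]
    exact mul_le_of_le_one_right h0 (abs_avg_le p _ h hp)

/-- splitting sums over functions along a predicate -/
theorem sum_split {C : Type*} [Fintype C] (H : ι → Prop) [DecidablePred H] (w : C → ℝ)
    (G : ({i // H i} → C) → ({i // ¬ H i} → C) → ℝ) :
    ∑ c : ι → C, (∏ i, w (c i)) * G (fun i => c i) (fun i => c i) =
    ∑ c1 : {i // H i} → C, ∑ c2 : {i // ¬ H i} → C,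
      (∏ i, w (c1 i)) * (∏ i, w (c2 i)) * G c1 c2 := by
  rw [← sum_product', univ_product_univ]
  apply Fintype.sum_equiv (Equiv.piEquivPiSubtypeProd H (fun _ => C))
  intro c
  rw [← Fintype.prod_subtype_mul_prod_subtype H (fun i => w (c i))]
  rfl

theorem NC_le (A : ℕ) (x : ℝ) (hx : 0 ≤ x) (hA : A * x ≤ 1) (M : ℕ) (H : ι → Prop) [DecidablePred H]
    (h1 : Fintype.card {i // H i} = M) (h2 : Fintype.card {i // ¬ H i} = M) :
    NC A x ι ≤ (1 - A * x + A * x * Real.exp (-(x * M))) ^ M := by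
  classical
  have hw : ∀ o, 0 ≤ wgt A x o := by
    intro o; unfold wgt; split_ifs <;> linarith
  -- injectivity on the first half
  set I1 : ({i // H i} → Option (Fin A)) → Prop := fun c1 => ∀ i j, c1 i = c1 j → c1 i ≠ none → i = j
  set ok : ({i // H i} → Option (Fin A)) → Option (Fin A) → Prop :=
    fun c1 o => o = none ∨ ∀ i, c1 i ≠ o
  have step1 : NC A x ι ≤ ∑ c : ι → Option (Fin A), (∏ i, wgt A x (c i)) *
      (fun (c1 : {i // H i} → Option (Fin A)) (c2 : {i // ¬ H i} → Option (Fin A)) =>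
        if I1 c1 then ∏ j, (if ok c1 (c2 j) then (1:ℝ) else 0) else 0) (fun i => c i) (fun i => c i) := by
    unfold NC
    apply sum_le_sum
    intro c _
    apply mul_le_mul_of_nonneg_left _ (prod_nonneg fun i _ => hw _)
    have hnn : ∀ (c1 : {i // H i} → Option (Fin A)) (c2 : {i // ¬ H i} → Option (Fin A)),
        (0:ℝ) ≤ ∏ j, (if ok c1 (c2 j) then (1:ℝ) else 0) := by
      intro c1 c2
      apply prod_nonneg; intro j _; split_ifs <;> norm_num
    by_cases h : Function.Injective (rep c)
    · have hI : I1 (fun i => c i) := by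
        intro i j hij hn
        exact Subtype.ext (h ((rep_eq_iff c _ _).mpr (Or.inr ⟨hij, hn⟩)))
      have hok : ∀ j : {i // ¬ H i}, ok (fun i => c i) (c j) := by
        intro j
        by_cases hj : c j = none
        · exact Or.inl hj
        · right
          intro i hij
          simp only at hij
          have : (i : ι) = j := h ((rep_eq_iff c _ _).mpr (Or.inr ⟨hij, by rw [hij]; exact hj⟩))
          exact j.2 (this ▸ i.2)
      simp only [if_pos h, if_pos hI]
      rw [prod_eq_one]
      intro j _
      rw [if_pos (hok j)]
    · rw [if_neg h]
      simp only
      split_ifs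
      · exact hnn _ _
      · exact le_rfl
  refine step1.trans ((sum_split H (wgt A x) (fun (c1 : {i // H i} → Option (Fin A)) (c2 : {i // ¬ H i} → Option (Fin A)) =>
        if I1 c1 then ∏ j, (if ok c1 (c2 j) then (1:ℝ) else 0) else 0)).trans_le ?_)
  have hcard : ∀ c1 : {i // H i} → Option (Fin A), I1 c1 →
      ∑ o, wgt A x o * (if ok c1 o then (1:ℝ) else 0) = 1 - (univ.filter fun i => c1 i ≠ none).card * x := by
    intro c1 hc1
    have e1 : ∑ o, wgt A x o * (if ok c1 o then (1:ℝ) else 0) =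
        ∑ o, wgt A x o - ∑ o, (if ok c1 o then (0:ℝ) else x) := by
      rw [← sum_sub_distrib]
      apply sum_congr rfl
      intro o _
      by_cases ho : ok c1 o
      · simp [ho]
      · have : o ≠ none := fun h => ho (Or.inl h)
        simp [ho, wgt, this]
    rw [e1, wgt_sum, sum_ite]
    simp only [sum_const_zero, zero_add, sum_const, nsmul_eq_mul]
    congr 3
    symm
    apply card_bij (fun i _ => c1 i)
    · intro i hi
      simp only [mem_filter, mem_univ, true_and] at hi ⊢
      rintro (h | h)
      · exact hi h
      · exact h i rfl
    · intro i hi j hj hij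
      simp only [mem_filter, mem_univ, true_and] at hi
      exact hc1 i j hij hi
    · intro o ho
      simp only [mem_filter, mem_univ, true_and, ok] at ho
      push Not at ho
      obtain ⟨ho1, i, hi⟩ := ho
      exact ⟨i, by simp [hi, ho1], hi⟩
  calc _ ≤ ∑ c1 : {i // H i} → Option (Fin A), ∏ i, (wgt A x (c1 i) * (if c1 i = none then 1 else Real.exp (-(x * M)))) := by
        apply sum_le_sum
        intro c1 _
        simp_rw [mul_assoc, ← mul_sum]
        rw [prod_mul_distrib]
        apply mul_le_mul_of_nonneg_left _ (prod_nonneg fun i _ => hw _)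
        by_cases hI : I1 c1
        · simp only [if_pos hI, ← prod_mul_distrib]
          rw [sum_prod_pi (fun _ o => wgt A x o * (if ok c1 o then (1:ℝ) else 0))]
          simp only [prod_const, card_univ, h2]
          have hnn : 0 ≤ ∑ o, wgt A x o * (if ok c1 o then (1:ℝ) else 0) := by
            apply sum_nonneg; intro o _
            apply mul_nonneg (hw o); split_ifs <;> norm_num
          rw [prod_ite, prod_const_one, one_mul, prod_const, ← Real.exp_nat_mul]
          have hk := hcard c1 hI
          set k := (univ.filter fun i => c1 i ≠ none).card with hkd
          calc _ ≤ (Real.exp (-(k * x))) ^ M := by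
                apply pow_le_pow_left₀ hnn
                rw [hk]
                have := Real.add_one_le_exp (-((k:ℝ) * x))
                linarith
            _ = _ := by
                rw [← Real.exp_nat_mul]
                congr 1
                rw [hkd]
                ring
        · simp only [if_neg hI, mul_zero, sum_const_zero]
          apply prod_nonneg
          intro i _
          split_ifs
          · norm_num
          · positivity
    _ = _ := by
        rw [sum_prod_pi (fun _ o => wgt A x o * (if o = none then 1 else Real.exp (-(x * M))))]
        simp only [prod_const, card_univ, h1]
        rw [Fintype.sum_option]
        simp [wgt]
        ring
end MODEL

section POLYQ
set_option linter.unusedSectionVars false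
open Polynomial

/-- bivariate polynomial functions of total degree at most `D`, seen through affine substitutions -/
def IsP (D : ℕ) (q : ℝ → ℝ → ℝ) : Prop :=
  ∀ a b : ℝ[X], a.natDegree ≤ 1 → b.natDegree ≤ 1 →
    ∃ r : ℝ[X], r.natDegree ≤ D ∧ ∀ t, r.eval t = q (a.eval t) (b.eval t)

theorem IsP.mono {D D' : ℕ} {q} (h : IsP D q) (hD : D ≤ D') : IsP D' q := by
  intro a b ha hb
  obtain ⟨r, hr, hr'⟩ := h a b ha hb
  exact ⟨r, hr.trans hD, hr'⟩

theorem IsP.const (c : ℝ) : IsP 0 (fun _ _ => c) := by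
  intro a b _ _
  exact ⟨C c, by simp, by simp⟩

theorem IsP.fst : IsP 1 (fun α _ => α) := fun a _ ha _ => ⟨a, ha, fun _ => rfl⟩
theorem IsP.snd : IsP 1 (fun _ x => x) := fun _ b _ hb => ⟨b, hb, fun _ => rfl⟩

theorem IsP.add {D : ℕ} {q q'} (h : IsP D q) (h' : IsP D q') : IsP D (fun α x => q α x + q' α x) := by
  intro a b ha hb
  obtain ⟨r, hr, hr'⟩ := h a b ha hb
  obtain ⟨s, hs, hs'⟩ := h' a b ha hb
  exact ⟨r + s, natDegree_add_le_of_degree_le hr hs, by intro t; simp [hr', hs']⟩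

theorem IsP.mul {D D' : ℕ} {q q'} (h : IsP D q) (h' : IsP D' q') :
    IsP (D + D') (fun α x => q α x * q' α x) := by
  intro a b ha hb
  obtain ⟨r, hr, hr'⟩ := h a b ha hb
  obtain ⟨s, hs, hs'⟩ := h' a b ha hb
  exact ⟨r * s, natDegree_mul_le.trans (add_le_add hr hs), by intro t; simp [hr', hs']⟩

theorem IsP.cmul {D : ℕ} {q} (c : ℝ) (h : IsP D q) : IsP D (fun α x => c * q α x) := by
  have := (IsP.const c).mul h
  rwa [zero_add] at this

theorem IsP.sum {D : ℕ} {I : Type*} (s : Finset I) (q : I → ℝ → ℝ → ℝ) (h : ∀ i ∈ s, IsP D (q i)) :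
    IsP D (fun α x => ∑ i ∈ s, q i α x) := by
  classical
  induction s using Finset.induction_on with
  | empty => simpa using (IsP.const 0).mono (Nat.zero_le D)
  | insert i s hi ih =>
    simp only [sum_insert hi]
    exact (h i (mem_insert_self _ _)).add (ih fun j hj => h j (mem_insert_of_mem hj))

theorem IsP.prod {I : Type*} (s : Finset I) (q : I → ℝ → ℝ → ℝ) (h : ∀ i ∈ s, IsP 1 (q i)) :
    IsP s.card (fun α x => ∏ i ∈ s, q i α x) := by
  classical
  induction s using Finset.induction_on with
  | empty => simpa using (IsP.const 1)
  | insert i s hi ih =>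
    simp only [prod_insert hi]
    rw [card_insert_of_notMem hi, add_comm]
    exact (h i (mem_insert_self _ _)).mul (ih fun j hj => h j (mem_insert_of_mem hj))

theorem IsP.pow {q} (h : IsP 1 q) (k : ℕ) : IsP k (fun α x => q α x ^ k) := by
  have := IsP.prod (range k) (fun _ => q) (fun _ _ => h)
  simpa using this

section PAT
variable {τ : Type*} [Fintype τ] [DecidableEq τ]

def pat {A : ℕ} (c : τ → Option (Fin A)) : τ → τ → Bool :=
  fun i j => decide (c i = c j ∧ c i ≠ none)

theorem pat_count (π : τ → τ → Bool) (A₀ : ℕ) (c₀ : τ → Option (Fin A₀)) (h₀ : pat c₀ = π) :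
    ∃ κ : ℕ, κ ≤ (univ.filter fun i => π i i = true).card ∧
      (κ = (univ.filter fun i => π i i = true).card → ∀ i j, π i j = true → i = j) ∧
      ∀ A : ℕ, (univ.filter fun c : τ → Option (Fin A) => pat c = π).card = A.descFactorial κ := by
  classical
  have hπ : ∀ i j, π i j = true ↔ (c₀ i = c₀ j ∧ c₀ i ≠ none) := by
    intro i j; rw [← h₀]; simp [pat]
  let S := {i // π i i = true}
  let st : Setoid S :=
    { r := fun i j => π i.1 j.1 = true
      iseqv := by
        refine ⟨fun i => i.2, ?_, ?_⟩
        · intro i j h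
          rw [hπ] at h ⊢
          exact ⟨h.1.symm, h.1 ▸ h.2⟩
        · intro i j k h h'
          rw [hπ] at h h' ⊢
          exact ⟨h.1.trans h'.1, h.2⟩ }
  have hS : (univ.filter fun i => π i i = true).card = Fintype.card S := by
    rw [Fintype.card_subtype]
  refine ⟨Fintype.card (Quotient st), ?_, ?_, ?_⟩
  · rw [hS]
    exact Fintype.card_le_of_surjective (Quotient.mk st) Quotient.mk_surjective
  · intro hc i j hij
    rw [hS] at hc
    have hb : Function.Bijective (Quotient.mk st) := by
      rw [Fintype.bijective_iff_surjective_and_card]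
      exact ⟨Quotient.mk_surjective, hc.symm⟩
    have hi : π i i = true := by
      rw [hπ] at hij ⊢; exact ⟨rfl, hij.2⟩
    have hj : π j j = true := by
      rw [hπ] at hij ⊢; exact ⟨rfl, hij.1 ▸ hij.2⟩
    have := hb.1 (a₁ := ⟨i, hi⟩) (a₂ := ⟨j, hj⟩) (Quotient.sound hij)
    exact congrArg Subtype.val this
  · intro A
    rw [← Fintype.card_subtype]
    have hcard : A.descFactorial (Fintype.card (Quotient st)) = Fintype.card (Quotient st ↪ Fin A) := by
      rw [Fintype.card_embedding_eq, Fintype.card_fin]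
    rw [hcard]
    symm
    let Φ : (Quotient st ↪ Fin A) → (τ → Option (Fin A)) :=
      fun e i => if h : π i i = true then some (e (Quotient.mk st ⟨i, h⟩)) else none
    have hΦ : ∀ e, pat (Φ e) = π := by
      intro e
      funext i j
      rw [Bool.eq_iff_iff]
      simp only [pat, decide_eq_true_eq, Φ]
      by_cases hi : π i i = true
      · by_cases hj : π j j = true
        · rw [dif_pos hi, dif_pos hj]
          constructor
          · rintro ⟨h, _⟩
            exact Quotient.exact (e.injective (Option.some_injective _ h))
          · intro h
            refine ⟨?_, by simp⟩
            congr 2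
            exact Quotient.sound h
        · rw [dif_pos hi, dif_neg hj]
          constructor
          · rintro ⟨h, _⟩; simp at h
          · intro h
            exfalso; apply hj
            rw [hπ] at h ⊢
            exact ⟨rfl, h.1 ▸ h.2⟩
      · rw [dif_neg hi]
        constructor
        · rintro ⟨_, h⟩; exact absurd rfl h
        · intro h
          exfalso; apply hi
          rw [hπ] at h ⊢
          exact ⟨rfl, h.2⟩
    apply Fintype.card_of_bijective (f := fun e => (⟨Φ e, hΦ e⟩ : {c : τ → Option (Fin A) // pat c = π}))
    constructor
    · intro e e' h
      have h' : Φ e = Φ e' := congrArg Subtype.val h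
      ext q
      obtain ⟨⟨i, hi⟩, rfl⟩ := Quotient.mk_surjective q
      have := congrFun h' i
      simp only [Φ, dif_pos hi] at this
      exact congrArg _ (Option.some_injective _ this)
    · rintro ⟨c, hc⟩
      have hcπ : ∀ i j, π i j = true ↔ (c i = c j ∧ c i ≠ none) := by
        intro i j; rw [← hc]; simp [pat]
      have hsome : ∀ i : S, ∃ a, c i.1 = some a := fun i =>
        Option.ne_none_iff_exists'.mp ((hcπ _ _).mp i.2).2
      choose v hv using hsome
      let e : Quotient st ↪ Fin A :=
        { toFun := Quotient.lift v (by
            intro i j hij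
            have := ((hcπ _ _).mp hij).1
            rw [hv, hv] at this
            exact Option.some_injective _ this)
          inj' := by
            intro q q'
            obtain ⟨i, rfl⟩ := Quotient.mk_surjective q
            obtain ⟨j, rfl⟩ := Quotient.mk_surjective q'
            intro h
            apply Quotient.sound
            show π i.1 j.1 = true
            rw [hcπ, hv, hv]
            exact ⟨congrArg some h, by simp⟩ }
      refine ⟨e, Subtype.ext ?_⟩
      funext i
      simp only [Φ]
      split_ifs with hi
      · exact (hv ⟨i, hi⟩).symm
      · by_contra hne
        apply hi
        rw [hcπ]
        exact ⟨rfl, fun h => hne h.symm⟩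

theorem cast_descFactorial_prod (A κ : ℕ) :
    ((A.descFactorial κ : ℕ) : ℝ) = ∏ j ∈ range κ, ((A:ℝ) - j) := by
  induction κ with
  | zero => simp
  | succ k ih =>
    rw [prod_range_succ, ← ih, Nat.descFactorial_succ, Nat.cast_mul]
    rcases le_or_gt k A with h | h
    · rw [Nat.cast_sub h]; ring
    · rw [Nat.descFactorial_eq_zero_iff_lt.mpr h]; simp

theorem pat_sum : ∃ q : (τ → τ → Bool) → ℝ → ℝ → ℝ,
    (∀ π, IsP (Fintype.card τ) (q π)) ∧
    (∀ π α, q π α 0 ≠ 0 → ∀ i j, π i j = true → i = j) ∧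
    ∀ (Ψ : (τ → τ → Bool) → ℝ) (A : ℕ) (x : ℝ),
      ∑ c : τ → Option (Fin A), (∏ i, wgt A x (c i)) * Ψ (pat c) = ∑ π, Ψ π * q π (A * x) x := by
  classical
  have key : ∀ π : τ → τ → Bool, ∃ q : ℝ → ℝ → ℝ, IsP (Fintype.card τ) q ∧
      (∀ α, q α 0 ≠ 0 → ∀ i j, π i j = true → i = j) ∧
      ∀ (A : ℕ) (x : ℝ), ∑ c ∈ univ.filter (fun c : τ → Option (Fin A) => pat c = π), (∏ i, wgt A x (c i))
        = q (A * x) x := by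
    intro π
    by_cases hv : ∃ (A₀ : ℕ) (c₀ : τ → Option (Fin A₀)), pat c₀ = π
    · obtain ⟨A₀, c₀, h₀⟩ := hv
      obtain ⟨κ, h1, h2, h3⟩ := pat_count π A₀ c₀ h₀
      set s := (univ.filter fun i => π i i = true).card with hs
      set n0 := (univ.filter fun i => ¬ π i i = true).card with hn0
      have hcard : s + n0 = Fintype.card τ := by
        rw [hs, hn0, card_filter_add_card_filter_not, card_univ]
      refine ⟨fun α x => (1 - α) ^ n0 * x ^ (s - κ) * ∏ j ∈ range κ, (α - j * x), ?_, ?_, ?_⟩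
      · have e1 : IsP 1 (fun α _ => 1 - α) := by
          have := ((IsP.const 1).mono (Nat.zero_le 1)).add (IsP.fst.cmul (-1))
          simpa [sub_eq_add_neg] using this
        have e2 : ∀ j : ℕ, IsP 1 (fun α x => α - j * x) := by
          intro j
          have := IsP.fst.add (IsP.snd.cmul (-(j:ℝ)))
          simpa [sub_eq_add_neg] using this
        have e3 := ((e1.pow n0).mul (IsP.snd.pow (s - κ))).mul
          (IsP.prod (range κ) (fun j α x => α - j * x) (fun j _ => e2 j))
        refine e3.mono ?_
        rw [card_range]; omega
      · intro α hα
        apply h2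
        by_contra hne
        apply hα
        have : s - κ ≠ 0 := by omega
        simp [this]
      · intro A x
        have hw : ∀ c ∈ univ.filter (fun c : τ → Option (Fin A) => pat c = π),
            ∏ i, wgt A x (c i) = (1 - A * x) ^ n0 * x ^ s := by
          intro c hc
          simp only [mem_filter, mem_univ, true_and] at hc
          have : ∀ i, wgt A x (c i) = if π i i = true then x else 1 - A * x := by
            intro i
            rw [← hc]
            by_cases h : c i = none <;> simp [wgt, pat, h]
          simp_rw [this]
          rw [prod_ite, prod_const, prod_const, mul_comm]
        rw [sum_congr rfl hw, sum_const, h3, nsmul_eq_mul, cast_descFactorial_prod]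
        have : ∏ j ∈ range κ, ((A:ℝ) * x - j * x) = (∏ j ∈ range κ, ((A:ℝ) - j)) * x ^ κ := by
          simp_rw [← sub_mul]
          rw [prod_mul_distrib, prod_const, card_range]
        simp only
        rw [this]
        have hx : x ^ s = x ^ (s - κ) * x ^ κ := by rw [← pow_add]; congr 1; omega
        rw [hx]; ring
    · refine ⟨fun _ _ => 0, (IsP.const 0).mono (Nat.zero_le _), by simp, ?_⟩
      intro A x
      rw [filter_false_of_mem]
      · simp
      · intro c _ hc
        exact hv ⟨A, c, hc⟩
  choose q hq1 hq2 hq3 using key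
  refine ⟨q, hq1, hq2, ?_⟩
  intro Ψ A x
  rw [← sum_fiberwise univ (fun c : τ → Option (Fin A) => pat c)]
  apply sum_congr rfl
  intro π _
  rw [← hq3, mul_sum]
  apply sum_congr rfl
  intro c hc
  simp only [mem_filter, mem_univ, true_and] at hc
  rw [hc, mul_comm]
end PAT

variable {ι : Type*} [Fintype ι] [DecidableEq ι]

def Good (D : ℕ) (p : (ι → ι) → ℝ) : Prop :=
  ∃ q : ℝ → ℝ → ℝ, IsP D q ∧ (∀ (A : ℕ) (x : ℝ), q (A * x) x = EE A x p) ∧ q (1/2) 0 = avg p id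

theorem Good.zero (D : ℕ) : Good D (0 : (ι → ι) → ℝ) :=
  ⟨fun _ _ => 0, (IsP.const 0).mono (Nat.zero_le _), by simp [EE, avg], by simp [avg]⟩

theorem Good.add {D : ℕ} {p p' : (ι → ι) → ℝ} (h : Good D p) (h' : Good D p') : Good D (p + p') := by
  obtain ⟨q, h1, h2, h3⟩ := h
  obtain ⟨q', h1', h2', h3'⟩ := h'
  have hav : ∀ r, avg (p + p') r = avg p r + avg p' r := by
    intro r; simp [avg, sum_add_distrib, add_div]
  refine ⟨_, h1.add h1', ?_, ?_⟩
  · intro A x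
    rw [h2, h2']
    simp only [EE, hav, mul_add, sum_add_distrib]
  · rw [h3, h3', hav]

theorem Good.smul {D : ℕ} {p : (ι → ι) → ℝ} (c : ℝ) (h : Good D p) : Good D (c • p) := by
  obtain ⟨q, h1, h2, h3⟩ := h
  have hav : ∀ r, avg (c • p) r = c * avg p r := by
    intro r; simp [avg, ← mul_sum, mul_div_assoc]
  refine ⟨_, h1.cmul c, ?_, ?_⟩
  · intro A x
    rw [h2]
    simp only [EE, hav, mul_sum]
    refine sum_congr rfl fun _ _ => by ring
  · rw [h3, hav]

theorem good_of_dep' {D : ℕ} (f : (ι → ι) → ℝ) (H : ι → Prop) [DecidablePred H]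
    (hf : DepOn f (univ.filter H)) (hcT : Fintype.card {i // H i} ≤ D) :
    Good D f := by
  classical
  obtain ⟨q, hq1, hq2, hq3⟩ := pat_sum (τ := {i // H i})
  let R : ({i // H i} → {i // H i} → Bool) → (ι → ι) → Prop :=
    fun π v => ∀ i j : {i // H i}, v i = v j ↔ (i = j ∨ π i j = true)
  let Ψ : ({i // H i} → {i // H i} → Bool) → ℝ :=
    fun π => if h : ∃ v, R π v then avg f h.choose else 0
  have hΨ : ∀ π v, R π v → Ψ π = avg f v := by
    intro π v hv
    have h : ∃ v, R π v := ⟨v, hv⟩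
    simp only [Ψ, dif_pos h]
    apply avg_congr f _ hf
    intro i hi j hj
    replace hi := (mem_filter.mp hi).2
    replace hj := (mem_filter.mp hj).2
    have e1 := h.choose_spec ⟨i, hi⟩ ⟨j, hj⟩
    have e2 := hv ⟨i, hi⟩ ⟨j, hj⟩
    simp only at e1 e2
    rw [e1, e2]
  have hE : ∀ (A : ℕ) (x : ℝ), EE A x f = ∑ π, Ψ π * q π (A * x) x := by
    intro A x
    rw [← hq3]
    have e : ∀ c : ι → Option (Fin A), avg f (rep c) =
        (fun (c1 : {i // H i} → Option (Fin A)) (_ : {i // ¬ H i} → Option (Fin A)) => Ψ (pat c1))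
          (fun i => c i) (fun i => c i) := by
      intro c
      symm
      apply hΨ
      intro i j
      rw [rep_eq_iff]
      simp only [pat, decide_eq_true_eq, Subtype.ext_iff]
    unfold EE
    simp_rw [e]
    refine (sum_split H (wgt A x) (fun (c1 : {i // H i} → Option (Fin A)) (_ : {i // ¬ H i} → Option (Fin A)) => Ψ (pat c1))).trans ?_
    apply sum_congr rfl
    intro c1 _
    rw [← sum_mul, ← mul_sum, sum_prod_pi (fun _ o => wgt A x o), wgt_sum, prod_const_one, mul_one]
  refine ⟨fun α x => ∑ π, Ψ π * q π α x, ?_, ?_, ?_⟩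
  · apply IsP.sum
    intro π _
    exact ((hq1 π).cmul _).mono hcT
  · intro A x; exact (hE A x).symm
  · have h1 : ∀ (A : ℕ) (x : ℝ), ∑ π, q π (A * x) x = 1 := by
      intro A x
      have := hq3 (fun _ => 1) A x
      simp only [mul_one, one_mul] at this
      rw [← this, sum_prod_pi (fun _ o => wgt A x o), wgt_sum, prod_const_one]
    have h2 : ∑ π, q π (1/2) 0 = 1 := by
      obtain ⟨r, _, hr⟩ := IsP.sum univ q (fun π _ => hq1 π) (C (1/2)) X (by simp) (by simp)
      have hr1 : r = 1 := by
        apply Polynomial.eq_of_infinite_eval_eq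
        apply Set.infinite_of_injective_forall_mem (f := fun A : ℕ => (1:ℝ) / (2 * ((A:ℝ) + 1)))
        · intro A B h
          have h' : (1:ℝ) / (2 * ((A:ℝ) + 1)) = 1 / (2 * ((B:ℝ) + 1)) := h
          rw [div_eq_div_iff (by positivity) (by positivity)] at h'
          have : (A:ℝ) = B := by linarith
          exact_mod_cast this
        · intro A
          show r.eval _ = (1 : ℝ[X]).eval _
          rw [hr, eval_one, eval_C, eval_X]
          have e1 := h1 (A + 1) (1 / (2 * ((A:ℝ) + 1)))
          have : ((A + 1 : ℕ) : ℝ) * (1 / (2 * ((A:ℝ) + 1))) = 1 / 2 := by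
            push_cast; field_simp
          rw [this] at e1
          exact e1
      have := hr 0
      rw [hr1] at this
      simpa using this.symm
    have h3 : ∀ π, Ψ π * q π (1/2) 0 = avg f id * q π (1/2) 0 := by
      intro π
      by_cases h : q π (1/2) 0 = 0
      · rw [h]; simp
      · congr 1
        apply hΨ
        intro i j
        constructor
        · intro hij; exact Or.inl (Subtype.ext hij)
        · rintro (hij | hij)
          · rw [hij]
          · rw [hq2 π _ h i j hij]
    simp only [h3]
    rw [← mul_sum, h2, mul_one]

theorem good_of_dep {D : ℕ} (f : (ι → ι) → ℝ) (T : Finset ι) (hf : DepOn f T) (hT : T.card ≤ D) :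
    Good D f := by
  apply good_of_dep' f (fun i => i ∈ T)
  · simpa using hf
  · simpa using hT
end POLYQ

section PRIMAL
open Polynomial
variable {ι : Type*} [Fintype ι] [DecidableEq ι]

theorem NC_le_exp (A : ℕ) (x a : ℝ) (ha : 0 ≤ a) (hx : a ≤ x) (hA : A * x ≤ 1) (hA' : 1/8 ≤ A * x)
    (M : ℕ) (H : ι → Prop) [DecidablePred H]
    (h1 : Fintype.card {i // H i} = M) (h2 : Fintype.card {i // ¬ H i} = M) :
    NC A x ι ≤ Real.exp (-((M:ℝ) / 8 * (1 - Real.exp (-(a * M))))) := by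
  refine (NC_le A x (ha.trans hx) hA M H h1 h2).trans ?_
  have hexp : Real.exp (-(x * M)) ≤ Real.exp (-(a * M)) := by
    apply Real.exp_le_exp.mpr
    have : a * M ≤ x * M := by gcongr
    linarith
  have hexp1 : Real.exp (-(a * M)) ≤ 1 := by
    rw [Real.exp_le_one_iff]
    have : 0 ≤ a * M := by positivity
    linarith
  have hp := Real.exp_pos (-(x * M))
  have h0 : 0 ≤ 1 - A * x + A * x * Real.exp (-(x * M)) := by
    have : 0 ≤ A * x * Real.exp (-(x * M)) := by positivity
    linarith
  calc _ ≤ (Real.exp (-(1/8 * (1 - Real.exp (-(a * M)))))) ^ M := by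
        apply pow_le_pow_left₀ h0
        refine le_trans ?_ (Real.add_one_le_exp _)
        nlinarith
    _ = _ := by
        rw [← Real.exp_nat_mul]
        congr 1
        ring

theorem primal_bound {D : ℕ} (p : (ι → ι) → ℝ) (hG : Good D p)
    (hp : ∀ g : ι → ι, ¬ Function.Injective g → |p g| ≤ 1)
    (M : ℕ) (H : ι → Prop) [DecidablePred H]
    (h1 : Fintype.card {i // H i} = M) (h2 : Fintype.card {i // ¬ H i} = M)
    (a : ℝ) (ha : 0 < a) (ha1 : a < 1 / (2 * D + 3))
    (hD : 4 * (D:ℝ) ^ 2 * a ≤ 1 / (2 * D + 3) - a)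
    (hδ : 4 * (3 + 2 * Real.log (1 / a)) * Real.exp (-((M:ℝ) / 8 * (1 - Real.exp (-(a * M))))) ≤ 1) :
    |avg p id| ≤ 4 * (3 + 2 * Real.log (1 / a)) := by
  obtain ⟨q, hq1, hq2, hq3⟩ := hG
  set δ := Real.exp (-((M:ℝ) / 8 * (1 - Real.exp (-(a * M))))) with hδd
  set Λ := 3 + 2 * Real.log (1 / a) with hΛ
  have hb3 : (1:ℝ) / (2 * D + 3) ≤ 1 / 3 := by
    apply one_div_le_one_div_of_le (by norm_num)
    have : (0:ℝ) ≤ D := Nat.cast_nonneg D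
    linarith
  have ha3 : a < 1 := by linarith
  have hlog : 0 ≤ Real.log (1 / a) := by
    apply Real.log_nonneg
    rw [le_div_iff₀ ha]; linarith
  have hΛ0 : 0 < Λ := by rw [hΛ]; linarith
  have hδ0 : 0 < δ := Real.exp_pos _
  set u := avg p id with hu
  obtain ⟨r1, hr1, hr1'⟩ := hq1 (C (1/2)) X (by simp) (by simp)
  set B := Λ * (δ * |u| + 1) with hB
  have hB0 : 0 < B := by positivity
  have hg : ∀ x, a ≤ x → x ≤ 1 / (2 * D + 3) → |r1.eval x| ≤ B := by
    intro x hax hxb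
    have hx0 : 0 < x := by linarith
    obtain ⟨r2, hr2, hr2'⟩ := hq1 (C x * X) (C x) ((natDegree_C_mul_le _ _).trans (by simp)) (by simp)
    set y := 1 / (2 * x) with hy
    have hyx : y * x = 1 / 2 := by rw [hy]; field_simp
    set m := ⌊y + 1 / 2⌋₊ with hm
    have hy0 : 0 < y := by positivity
    have hm1 : (m:ℝ) ≤ y + 1 / 2 := Nat.floor_le (by positivity)
    have hm2 : y + 1 / 2 < m + 1 := Nat.lt_floor_add_one _
    have hDy : (D:ℝ) + 3 / 2 ≤ y := by
      rw [hy, le_div_iff₀ (by positivity)]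
      rw [le_div_iff₀ (by positivity)] at hxb
      linarith
    have hmn : m ≤ 2 * (m / 2) + 1 := by omega
    have hmn' : (m:ℝ) ≤ 2 * ((m / 2 : ℕ) : ℝ) + 1 := by exact_mod_cast hmn
    have hmn2 : 2 * ((m / 2 : ℕ) : ℝ) ≤ m := by
      have : 2 * (m / 2) ≤ m := by omega
      exact_mod_cast this
    have hDn : D ≤ 2 * (m / 2) := by
      have : (D:ℝ) < 2 * ((m / 2 : ℕ) : ℝ) + 1 := by linarith
      have h : D < 2 * (m / 2) + 1 := by exact_mod_cast this
      omega
    have hx3 : x ≤ 1 / 3 := hxb.trans hb3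
    have hib := interp_bound r2 m (m / 2) (by omega) (hr2.trans hDn) (δ * |u| + 1) (by
      intro A hA1 hA2
      rw [hr2']
      simp only [eval_mul, eval_C, eval_X]
      rw [mul_comm x, hq2]
      have hA1' : (m:ℝ) ≤ A + ((m / 2 : ℕ) : ℝ) := by exact_mod_cast hA1
      have hA2' : (A:ℝ) ≤ m + ((m / 2 : ℕ) : ℝ) := by exact_mod_cast hA2
      have hAx1 : (A:ℝ) * x ≤ 1 := by
        have : (A:ℝ) ≤ 3 / 2 * y + 3 / 4 := by linarith
        calc (A:ℝ) * x ≤ (3 / 2 * y + 3 / 4) * x := by gcongr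
          _ = 3 / 2 * (y * x) + 3 / 4 * x := by ring
          _ ≤ 1 := by rw [hyx]; linarith
      have hAx2 : 1 / 8 ≤ (A:ℝ) * x := by
        have : y / 2 - 1 / 4 ≤ (A:ℝ) := by linarith
        calc (1:ℝ) / 8 ≤ (y * x) / 2 - x / 4 := by rw [hyx]; linarith
          _ = (y / 2 - 1 / 4) * x := by ring
          _ ≤ (A:ℝ) * x := by gcongr
      refine (abs_EE_le A x hx0.le hAx1 p hp).trans ?_
      gcongr
      exact NC_le_exp A x a ha.le hax hAx1 hAx2 M H h1 h2)
      (y - m) (by rw [abs_le]; constructor <;> linarith)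
    rw [add_sub_cancel, hr2'] at hib
    simp only [eval_mul, eval_C, eval_X] at hib
    rw [mul_comm x, hyx] at hib
    rw [hr1']
    simp only [eval_C, eval_X]
    refine hib.trans ?_
    rw [hB]
    apply mul_le_mul_of_nonneg_right _ (by positivity)
    rw [hΛ]
    have hl : Real.log ((m / 2 : ℕ) : ℝ) ≤ Real.log (1 / a) := by
      rcases Nat.eq_zero_or_pos (m / 2) with h | h
      · rw [h]; simpa using hlog
      · apply Real.log_le_log (by exact_mod_cast h)
        have hya : y ≤ 1 / a / 2 := by
          rw [hy, div_div]
          apply one_div_le_one_div_of_le (by positivity)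
          linarith
        have : 1 ≤ 1 / a := by rw [le_div_iff₀ ha]; linarith
        linarith
    linarith
  have hgb := growth_bound r1 D hr1 a (1 / (2 * D + 3)) B ha ha1 hB0 hg hD
  rw [hr1'] at hgb
  simp only [eval_C, eval_X] at hgb
  rw [hq3] at hgb
  have : Λ * δ * |u| ≤ 1 / 4 * |u| := by
    apply mul_le_mul_of_nonneg_right _ (abs_nonneg _)
    linarith
  have : B = Λ * δ * |u| + Λ := by rw [hB]; ring
  linarith
end PRIMAL

section EDD

def xof {k : ℕ} (g : Fin (2 ^ k) → Fin (2 ^ k)) : Fin (2 ^ k) × Fin k → Bool :=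
  fun p => decide (finFunctionFinEquiv.symm (g p.1) p.2 = 1)

theorem gOf_xof {k : ℕ} (g : Fin (2 ^ k) → Fin (2 ^ k)) : gOf (xof g) = g := by
  funext i
  unfold gOf
  rw [← Equiv.eq_symm_apply]
  funext j
  simp only [xof, decide_eq_true_eq]
  generalize finFunctionFinEquiv.symm (g i) j = y
  revert y
  decide

theorem ED_xof {k : ℕ} (g : Fin (2 ^ k) → Fin (2 ^ k)) :
    ED k (xof g) = true ↔ Function.Injective g := by
  unfold ED
  rw [gOf_xof]
  simp

theorem good_ch {k D : ℕ} (e : Fin (2 ^ k) × Fin k → Bool) (he : wt e < D + 1) :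
    Good D (fun g => ch e (xof g)) := by
  apply good_of_dep _ ((univ.filter fun v => e v = true).image Prod.fst)
  · intro g h hgh
    simp only [ch]
    apply prod_congr rfl
    rintro ⟨i, j⟩ _
    by_cases hv : e (i, j) = true
    · have : g i = h i := hgh i (mem_image.mpr ⟨(i, j), by simp [hv], rfl⟩)
      simp [xof, this]
    · simp [hv]
  · refine card_image_le.trans ?_
    unfold wt at he
    omega

theorem main_disc (k : ℕ) (hk : 1 ≤ k) {n t D : ℕ}
    (a : ℝ) (ha : 0 < a) (ha1 : a < 1 / (2 * D + 3))
    (hD : 4 * (D:ℝ) ^ 2 * a ≤ 1 / (2 * D + 3) - a)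
    (hδ : 4 * (3 + 2 * Real.log (1 / a)) *
      Real.exp (-(((2 ^ (k - 1) : ℕ) : ℝ) / 8 * (1 - Real.exp (-(a * ((2 ^ (k - 1) : ℕ) : ℝ)))))) ≤ 1)
    (e : Fin t × (Fin (2 ^ k) × Fin k) → Fin n) (he : Function.Injective e) (F : (Fin n → Bool) → Bool)
    (hF : ∀ x, F x = orBlock t (ED k) (fun v => x (e v))) :
    ∃ μ : (Fin n × Fin 4 → Bool) × (Fin n × Fin 4 → Bool) → ℝ,
          (∀ ab, 0 ≤ μ ab) ∧
          (∑ ab : (Fin n × Fin 4 → Bool) × (Fin n × Fin 4 → Bool), μ ab = 1) ∧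
          ∀ A B : Finset (Fin n × Fin 4 → Bool),
            |∑ a ∈ A, ∑ b ∈ B, μ (a, b) * bval (patMat F a b)| ≤
              (1 - 2 / (4 * (3 + 2 * Real.log (1 / a)) + 1)) ^ t + Real.sqrt (((2:ℝ) ^ (D + 1))⁻¹) := by
  classical
  set K := 4 * (3 + 2 * Real.log (1 / a)) with hK
  set U : (Fin (2 ^ k) × Fin k → Bool) → ℝ := fun x =>
    (∑ σ : Equiv.Perm (Fin (2 ^ k)), if xof (σ : Fin (2 ^ k) → Fin (2 ^ k)) = x then (1:ℝ) else 0) /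
      (Fintype.card (Equiv.Perm (Fin (2 ^ k))) : ℝ) with hU
  have hUp : ∀ p : (Fin (2 ^ k) × Fin k → Bool) → ℝ,
      ∑ x, U x * p x = avg (fun g => p (xof g)) id := by
    intro p
    simp only [hU, avg, div_mul_eq_mul_div, ← sum_div, sum_mul]
    congr 1
    rw [sum_comm]
    simp
  set L : Submodule ℝ ((Fin (2 ^ k) × Fin k → Bool) → ℝ) :=
    Submodule.span ℝ {p | ∃ e : Fin (2 ^ k) × Fin k → Bool, wt e < D + 1 ∧ p = ch e} with hL
  have hLg : ∀ p ∈ L, Good D (fun g => p (xof g)) := by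
    intro p hp
    induction hp using Submodule.span_induction with
    | mem p h =>
      obtain ⟨e, he, rfl⟩ := h
      exact good_ch e he
    | zero => exact Good.zero D
    | add p q _ _ hp hq => exact hp.add hq
    | smul c p _ hp => exact hp.smul c
  have hch : ∀ e : Fin (2 ^ k) × Fin k → Bool, wt e < D + 1 → ch e ∈ L := by
    intro e he
    exact Submodule.subset_span ⟨e, he, rfl⟩
  have hone : (fun _ => (1:ℝ)) ∈ L := by
    have := hch (fun _ => false) (by simp [wt])
    have h : ch (fun _ : Fin (2 ^ k) × Fin k => false) = fun _ => (1:ℝ) := by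
      funext x; simp [ch]
    rwa [h] at this
  have hpow : 2 ^ k = 2 ^ (k - 1) + 2 ^ (k - 1) := by
    obtain ⟨k', rfl⟩ := Nat.exists_eq_add_of_le' hk
    simp [pow_succ]; ring
  have hc1 : Fintype.card {i : Fin (2 ^ k) // i.val < 2 ^ (k - 1)} = 2 ^ (k - 1) := by
    rw [Fintype.card_subtype, Fin.card_filter_val_lt]
    exact min_eq_right (Nat.pow_le_pow_right (by norm_num) (by omega))
  have hc2 : Fintype.card {i : Fin (2 ^ k) // ¬ i.val < 2 ^ (k - 1)} = 2 ^ (k - 1) := by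
    rw [Fintype.card_subtype_compl, hc1, Fintype.card_fin]
    omega
  have hloga : 0 ≤ Real.log (1 / a) := by
    apply Real.log_nonneg
    have hb3 : (1:ℝ) / (2 * D + 3) ≤ 1 / 3 := by
      apply one_div_le_one_div_of_le (by norm_num)
      have : (0:ℝ) ≤ D := Nat.cast_nonneg D
      linarith
    rw [le_div_iff₀ ha]; linarith
  have hK0 : 0 < K := by rw [hK]; linarith
  obtain ⟨P, Q, hP0, hQ0, hP1, hQ1, hPf, hm, hQ⟩ := duality (ED k) U
    (by
      intro x
      apply div_nonneg _ (Nat.cast_nonneg _)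
      apply sum_nonneg
      intro σ _
      split_ifs <;> norm_num)
    (by
      have := hUp (fun _ => 1)
      simp only [mul_one] at this
      rw [this]
      simp [avg])
    (by
      intro x hx
      simp only [hU]
      rw [sum_eq_zero, zero_div]
      intro σ _
      rw [if_neg]
      rintro rfl
      rw [(ED_xof _).mpr σ.injective] at hx
      exact absurd hx (by simp))
    L hone K hK0
    (by
      intro p hp hb
      rw [hUp]
      apply primal_bound (fun g => p (xof g)) (hLg p hp) _ (2 ^ (k - 1)) (fun i => i.val < 2 ^ (k - 1)) hc1 hc2
        a ha ha1 hD hδ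
      intro g hg
      apply hb
      rw [← ED_xof] at hg
      simpa using hg)
  exact or_amp (ED k) P Q hP0 hQ0 hP1 hQ1 hPf (fun e he => hm _ (hch e he)) _ hQ e he F hF
end EDD

section FIN

theorem exists_level (n : ℕ) (hn : 32 ^ 5 * 15 ≤ n) :
    ∃ j : ℕ, 5 ≤ j ∧ 32 ^ j * (3 * j) ≤ n ∧ n < 32 ^ (j + 1) * (3 * (j + 1)) := by
  classical
  have hlt : ∀ j : ℕ, 1 ≤ j → j < 32 ^ j * (3 * j) := by
    intro j hj
    have : 1 ≤ 32 ^ j := Nat.one_le_pow _ _ (by norm_num)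
    nlinarith
  have h5 : 5 ≤ n := by omega
  set j := Nat.findGreatest (fun j => 32 ^ j * (3 * j) ≤ n) n with hj
  have hspec : 32 ^ j * (3 * j) ≤ n :=
    Nat.findGreatest_spec (P := fun j => 32 ^ j * (3 * j) ≤ n) (m := 5) h5 (by simpa using hn)
  have hge : 5 ≤ j := Nat.le_findGreatest h5 (by simpa using hn)
  refine ⟨j, hge, hspec, ?_⟩
  by_contra hcon
  push Not at hcon
  have h1 : j + 1 ≤ n := ((hlt (j + 1) (by omega)).trans_le hcon).le
  have : j + 1 ≤ j := Nat.le_findGreatest h1 hcon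
  omega

theorem pow_four_ge (j : ℕ) (hj : 5 ≤ j) : (176:ℝ) * j ≤ 4 ^ j := by
  induction j, hj using Nat.le_induction with
  | base => norm_num
  | succ j hj ih =>
    have : (5:ℝ) ≤ j := by exact_mod_cast hj
    rw [pow_succ]; push_cast; linarith

theorem pow_eight_ge (j : ℕ) (hj : 5 ≤ j) : (3328:ℝ) * j ≤ 8 ^ j := by
  induction j, hj using Nat.le_induction with
  | base => norm_num
  | succ j hj ih =>
    have : (5:ℝ) ≤ j := by exact_mod_cast hj
    rw [pow_succ]; push_cast; linarith

theorem exp_neg_le_half (y : ℝ) (h0 : 0 ≤ y) (h1 : y ≤ 1) : y / 2 ≤ 1 - Real.exp (-y) := by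
  have := Real.add_one_le_exp y
  have hp := Real.exp_pos (-y)
  have he : Real.exp (-y) * Real.exp y = 1 := by rw [← Real.exp_add]; simp
  nlinarith

theorem level_disc (j : ℕ) (hj : 5 ≤ j) {n : ℕ}
    (e : Fin (4 ^ j) × (Fin (2 ^ (3 * j)) × Fin (3 * j)) → Fin n) (he : Function.Injective e)
    (F : (Fin n → Bool) → Bool)
    (hF : ∀ x, F x = orBlock (4 ^ j) (ED (3 * j)) (fun v => x (e v))) :
    ∃ μ : (Fin n × Fin 4 → Bool) × (Fin n × Fin 4 → Bool) → ℝ,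
          (∀ ab, 0 ≤ μ ab) ∧
          (∑ ab : (Fin n × Fin 4 → Bool) × (Fin n × Fin 4 → Bool), μ ab = 1) ∧
          ∀ A B : Finset (Fin n × Fin 4 → Bool),
            |∑ a ∈ A, ∑ b ∈ B, μ (a, b) * bval (patMat F a b)| ≤
              (2:ℝ) ^ (-((4:ℝ) ^ j / (176 * j))) := by
  have hj' : (5:ℝ) ≤ j := by exact_mod_cast hj
  have hj0 : (0:ℝ) < j := by linarith
  set D := ⌊(4:ℝ) ^ j / (44 * j)⌋₊ with hDd
  have h4 := pow_four_ge j hj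
  have h8 := pow_eight_ge j hj
  have hDle : (D:ℝ) ≤ 4 ^ j / (44 * j) := Nat.floor_le (by positivity)
  have hDgt : (4:ℝ) ^ j / (44 * j) < D + 1 := Nat.lt_floor_add_one _
  have hD1 : (1:ℝ) ≤ D := by
    have : 1 ≤ D := by
      apply Nat.le_floor
      rw [le_div_iff₀ (by positivity)]
      push_cast; linarith
    exact_mod_cast this
  set a : ℝ := 3328 * j / 64 ^ j with had
  have ha : 0 < a := by positivity
  have h64 : (64:ℝ) ^ j = (4 ^ j) ^ 3 := by
    rw [← pow_mul, mul_comm, pow_mul]; norm_num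
  have h64' : (64:ℝ) ^ j = 8 ^ j * 8 ^ j := by
    rw [← mul_pow]; norm_num
  have hD3 : 25 * (D:ℝ) ^ 3 * a ≤ 1 := by
    have h1 : (D:ℝ) ^ 3 ≤ (4 ^ j / (44 * j)) ^ 3 := by gcongr
    have h2 : ((4:ℝ) ^ j / (44 * j)) ^ 3 = 64 ^ j / (85184 * j ^ 3) := by
      rw [div_pow, ← h64]; ring
    rw [h2] at h1
    calc 25 * (D:ℝ) ^ 3 * a ≤ 25 * ((64:ℝ) ^ j / (85184 * (j:ℝ) ^ 3)) * a := by gcongr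
      _ = (83200:ℝ) / (85184 * (j:ℝ) ^ 2) := by rw [had]; field_simp; norm_num
      _ ≤ 1 := by
        rw [div_le_one (by positivity)]
        nlinarith
  have hmain : (4 * (D:ℝ) ^ 2 + 1) * (2 * D + 3) * a ≤ 1 := by
    refine le_trans ?_ hD3
    apply mul_le_mul_of_nonneg_right _ ha.le
    have e1 : 4 * (D:ℝ) ^ 2 + 1 ≤ 5 * D ^ 2 := by nlinarith
    have e2 : 2 * (D:ℝ) + 3 ≤ 5 * D := by linarith
    calc (4 * (D:ℝ) ^ 2 + 1) * (2 * D + 3) ≤ (5 * (D:ℝ) ^ 2) * (5 * D) :=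
          mul_le_mul e1 e2 (by positivity) (by positivity)
      _ = 25 * (D:ℝ) ^ 3 := by ring
  have hb : (4 * (D:ℝ) ^ 2 + 1) * a ≤ 1 / (2 * D + 3) := by
    rw [le_div_iff₀ (by positivity)]; linarith
  have ha1 : a < 1 / (2 * D + 3) := by
    have : 0 < 4 * (D:ℝ) ^ 2 * a := by positivity
    linarith
  have hlog : Real.log (1 / a) ≤ 21 / 5 * j := by
    have h1 : (1:ℝ) / a ≤ 64 ^ j := by
      rw [had, one_div_div]
      apply div_le_self (by positivity)
      linarith
    calc Real.log (1 / a) ≤ Real.log (64 ^ j) := Real.log_le_log (by positivity) h1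
      _ = j * (6 * Real.log 2) := by
          rw [Real.log_pow, show (64:ℝ) = 2 ^ 6 by norm_num, Real.log_pow]; push_cast; ring
      _ ≤ 21 / 5 * j := by
          have := Real.log_two_lt_d9
          nlinarith
  have hlog0 : 0 ≤ Real.log (1 / a) := by
    apply Real.log_nonneg
    have hb3 : (1:ℝ) / (2 * D + 3) ≤ 1 := by
      rw [div_le_one (by positivity)]; linarith
    rw [le_div_iff₀ ha]; linarith
  have hM : (((2 ^ (3 * j - 1) : ℕ) : ℝ)) = 8 ^ j / 2 := by
    have : (2:ℝ) ^ (3 * j) = 2 ^ (3 * j - 1) * 2 := by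
      rw [← pow_succ]; congr 1; omega
    push_cast
    rw [show (8:ℝ) = 2 ^ 3 by norm_num, ← pow_mul, this]; ring
  have hδ : 4 * (3 + 2 * Real.log (1 / a)) *
      Real.exp (-(((2 ^ (3 * j - 1) : ℕ) : ℝ) / 8 * (1 - Real.exp (-(a * ((2 ^ (3 * j - 1) : ℕ) : ℝ)))))) ≤ 1 := by
    rw [hM]
    have hy : a * (8 ^ j / 2) = 1664 * j / 8 ^ j := by
      rw [had, h64']; field_simp; norm_num
    have hy1 : a * (8 ^ j / 2) ≤ 1 := by
      rw [hy, div_le_one (by positivity)]; linarith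
    have hh := exp_neg_le_half (a * (8 ^ j / 2)) (by positivity) hy1
    have hexp : Real.exp (-((8:ℝ) ^ j / 2 / 8 * (1 - Real.exp (-(a * (8 ^ j / 2)))))) ≤ Real.exp (-(52 * j)) := by
      apply Real.exp_le_exp.mpr
      have : (52:ℝ) * j = 8 ^ j / 2 / 8 * (a * (8 ^ j / 2) / 2) := by
        rw [hy]; field_simp; norm_num
      rw [this]
      apply neg_le_neg
      gcongr
    have h52 : (52:ℝ) * j ≤ Real.exp (52 * j) := by
      have := Real.add_one_le_exp ((52:ℝ) * j); linarith
    calc _ ≤ (52 * j) * Real.exp (-(52 * (j:ℝ))) :=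
          mul_le_mul (by linarith) hexp (Real.exp_pos _).le (by positivity)
      _ ≤ Real.exp (52 * j) * Real.exp (-(52 * (j:ℝ))) := by gcongr
      _ = 1 := by rw [← Real.exp_add]; simp
  obtain ⟨μ, h1, h2, h3⟩ := main_disc (3 * j) (by omega) (D := D) a ha ha1 (by linarith) hδ e he F hF
  refine ⟨μ, h1, h2, fun A B => (h3 A B).trans ?_⟩
  set K := 4 * (3 + 2 * Real.log (1 / a)) with hK
  have hK1 : 12 ≤ K := by rw [hK]; linarith
  have hK2 : K + 1 ≤ 47 * j := by rw [hK]; linarith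
  set y := (4:ℝ) ^ j / (88 * j) with hy
  have hy0 : 0 < y := by positivity
  have hl2 : Real.log 2 ≤ 1 := by have := Real.log_two_lt_d9; linarith
  have hl20 : 0 < Real.log 2 := Real.log_pos (by norm_num)
  have hfirst : (1 - 2 / (K + 1)) ^ (4 ^ j) ≤ (2:ℝ) ^ (-y) := by
    have h0 : 0 ≤ 1 - 2 / (K + 1) := by
      have : 2 / (K + 1) ≤ 1 := by rw [div_le_one (by linarith)]; linarith
      linarith
    have hk : 1 / (24 * (j:ℝ)) ≤ 2 / (K + 1) := by
      rw [div_le_div_iff₀ (by positivity) (by linarith)]; linarith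
    calc (1 - 2 / (K + 1)) ^ (4 ^ j) ≤ (Real.exp (-(1 / (24 * (j:ℝ))))) ^ (4 ^ j) := by
          apply pow_le_pow_left₀ h0
          have := Real.add_one_le_exp (-(1 / (24 * (j:ℝ))))
          linarith
      _ = Real.exp (-(4 ^ j / (24 * j))) := by
          rw [← Real.exp_nat_mul]; congr 1; push_cast; ring
      _ ≤ Real.exp (-y) := by
          apply Real.exp_le_exp.mpr
          apply neg_le_neg
          rw [hy]
          gcongr
          norm_num
      _ ≤ (2:ℝ) ^ (-y) := by
          rw [Real.rpow_def_of_pos (by norm_num)]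
          apply Real.exp_le_exp.mpr
          nlinarith
  have hsecond : Real.sqrt (((2:ℝ) ^ (D + 1))⁻¹) ≤ (2:ℝ) ^ (-y) := by
    apply Real.sqrt_le_iff.mpr
    refine ⟨by positivity, ?_⟩
    rw [← Real.rpow_natCast, ← Real.rpow_neg (by norm_num), ← Real.rpow_natCast, ← Real.rpow_mul (by norm_num)]
    apply Real.rpow_le_rpow_of_exponent_le (by norm_num)
    have : y * 2 = 4 ^ j / (44 * j) := by rw [hy]; field_simp; norm_num
    push_cast
    linarith
  have hy2 : (2:ℝ) ≤ y := by
    rw [hy, le_div_iff₀ (by positivity)]; linarith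
  calc _ ≤ (2:ℝ) ^ (-y) + (2:ℝ) ^ (-y) := add_le_add hfirst hsecond
    _ = (2:ℝ) ^ (1 - y) := by
        rw [sub_eq_add_neg, Real.rpow_add (by norm_num), Real.rpow_one]; ring
    _ ≤ _ := by
        apply Real.rpow_le_rpow_of_exponent_le (by norm_num)
        have : (4:ℝ) ^ j / (176 * j) = y / 2 := by rw [hy]; field_simp; norm_num
        rw [this]; linarith

theorem final_exponent (n j : ℕ) (hj : 5 ≤ j) (h1 : 32 ^ j * (3 * j) ≤ n)
    (h2 : n < 32 ^ (j + 1) * (3 * (j + 1))) :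
    (1 / 176 : ℝ) * (n : ℝ) ^ ((2 : ℝ) / 5) / (Real.logb 2 (n : ℝ)) ^ (2:ℝ) ≤ (4:ℝ) ^ j / (176 * j) := by
  have hj' : (5:ℝ) ≤ j := by exact_mod_cast hj
  have hj0 : (0:ℝ) < j := by linarith
  have hn32 : (32:ℝ) ^ j ≤ n := by
    have : 32 ^ j ≤ n := le_trans (Nat.le_mul_of_pos_right _ (by omega)) h1
    exact_mod_cast this
  have hlog : 5 * (j:ℝ) ≤ Real.logb 2 n := by
    rw [Real.le_logb_iff_rpow_le (by norm_num) (lt_of_lt_of_le (by positivity) hn32)]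
    refine le_trans (le_of_eq ?_) hn32
    rw [Real.rpow_mul (by norm_num), Real.rpow_natCast]
    congr 1
    norm_num
  have hnp : (n:ℝ) ^ ((2:ℝ) / 5) ≤ 24 * j * 4 ^ j := by
    have h2' : (n:ℝ) ≤ 32 ^ (j + 1) * (3 * (j + 1)) := by exact_mod_cast h2.le
    calc (n:ℝ) ^ ((2:ℝ) / 5) ≤ ((32:ℝ) ^ (j + 1) * (3 * (j + 1))) ^ ((2:ℝ) / 5) := by
          gcongr
      _ = ((32:ℝ) ^ (j + 1)) ^ ((2:ℝ) / 5) * (3 * ((j:ℝ) + 1)) ^ ((2:ℝ) / 5) :=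
          Real.mul_rpow (by positivity) (by positivity)
      _ ≤ 4 ^ (j + 1) * (3 * ((j:ℝ) + 1)) := by
          have e1 : ((32:ℝ) ^ (j + 1)) ^ ((2:ℝ) / 5) = 4 ^ (j + 1) := by
            rw [← Real.rpow_natCast, ← Real.rpow_mul (by norm_num), mul_comm, Real.rpow_mul (by norm_num),
              Real.rpow_natCast]
            congr 1
            rw [show (32:ℝ) = 2 ^ (5:ℝ) by norm_num, ← Real.rpow_mul (by norm_num)]
            norm_num
          rw [e1]
          gcongr
          calc (3 * ((j:ℝ) + 1)) ^ ((2:ℝ) / 5) ≤ (3 * ((j:ℝ) + 1)) ^ (1:ℝ) := by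
                apply Real.rpow_le_rpow_of_exponent_le (by linarith) (by norm_num)
            _ = _ := Real.rpow_one _
      _ ≤ 24 * j * 4 ^ j := by
          rw [pow_succ]
          have : (0:ℝ) < 4 ^ j := by positivity
          nlinarith
  have hl0 : 0 < Real.logb 2 n := by linarith
  rw [Real.rpow_two]
  calc (1 / 176 : ℝ) * (n : ℝ) ^ ((2 : ℝ) / 5) / (Real.logb 2 (n : ℝ)) ^ 2
      ≤ (1 / 176 : ℝ) * (24 * (j:ℝ) * (4:ℝ) ^ j) / (5 * (j:ℝ)) ^ 2 := by gcongr
    _ = (24 / 25 : ℝ) * ((4:ℝ) ^ j / (176 * (j:ℝ))) := by field_simp; norm_num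
    _ ≤ 4 ^ j / (176 * j) := by
        have : 0 < (4:ℝ) ^ j / (176 * j) := by positivity
        linarith

end FIN

/-- there are constants `c, C > 0` such that for all large `n` there is
an `OR ∘ ED` circuit `F` on `n` variables whose pattern-matrix composition `F'` has
discrepancy at most `2^{-c·n^{2/5}/(log₂ n)^C}`: some probability distribution `μ`
witnesses that every combinatorial rectangle has bias at most this bound. -/
theorem ac0_discrepancy :
    ∃ c C : ℝ, 0 < c ∧ 0 < C ∧ ∃ n₀ : ℕ, ∀ n : ℕ, n₀ ≤ n →
      ∃ F : (Fin n → Bool) → Bool, IsOrED F ∧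
        ∃ μ : (Fin n × Fin 4 → Bool) × (Fin n × Fin 4 → Bool) → ℝ,
          (∀ ab, 0 ≤ μ ab) ∧
          (∑ ab : (Fin n × Fin 4 → Bool) × (Fin n × Fin 4 → Bool), μ ab = 1) ∧
          ∀ A B : Finset (Fin n × Fin 4 → Bool),
            |∑ a ∈ A, ∑ b ∈ B, μ (a, b) * bval (patMat F a b)|
              ≤ (2 : ℝ) ^ (-(c * (n : ℝ) ^ ((2 : ℝ) / 5) / (Real.logb 2 (n : ℝ)) ^ C)) := by
  refine ⟨1 / 176, 2, by norm_num, by norm_num, 32 ^ 5 * 15, fun n hn => ?_⟩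
  obtain ⟨j, hj, h1, h2⟩ := exists_level n hn
  have hcard : 4 ^ j * (2 ^ (3 * j) * (3 * j)) ≤ n := by
    have : 4 ^ j * (2 ^ (3 * j) * (3 * j)) = 32 ^ j * (3 * j) := by
      rw [pow_mul, ← mul_assoc, ← mul_pow]; norm_num
    rw [this]; exact h1
  obtain ⟨e⟩ : Nonempty (Fin (4 ^ j) × (Fin (2 ^ (3 * j)) × Fin (3 * j)) ↪ Fin n) := by
    apply Function.Embedding.nonempty_of_card_le
    simpa using hcard
  refine ⟨fun x => orBlock (4 ^ j) (ED (3 * j)) (fun p => x (e p)),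
    ⟨4 ^ j, 3 * j, e, e.injective, hcard, fun x => rfl⟩, ?_⟩
  obtain ⟨μ, m1, m2, m3⟩ := level_disc j hj e e.injective
    (fun x => orBlock (4 ^ j) (ED (3 * j)) (fun p => x (e p))) (fun x => rfl)
  refine ⟨μ, m1, m2, fun A B => (m3 A B).trans ?_⟩
  apply Real.rpow_le_rpow_of_exponent_le (by norm_num)
  exact neg_le_neg (final_exponent n j hj h1 h2)

end
end
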